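/- arXiv:2211.12658 — 3 statements merged into one kernel-verified Lean document; each statement's English description precedes it below -/
import Mathlib

section
/- Let c ∈ (q, 1] and let {P_n^{(c)}}_{n≥0} be a family of monic orthogonal polynomials on the lattice ±c q^ℤ with weight w, with recurrence coefficients α_n^{(c)}, and set α_k^{(c)} = 0 for k ≤ 0. Then for every n ≥ 1 and every x ≠ 0: (P_n^{(c)}(q^{−1} x) − P_n^{(c)}(x)) / (x (q^{−1} − 1)) = [n]_{q^{−1}} P_{n−1}^{(c)}(x) + (q^{n−3}/(q^{−1} − 1)) α_n^{(c)} α_{n−1}^{(c)} α_{n−2}^{(c)} P_{n−3}^{(c)}(x), where [n]_{q^{−1}} = (q^{−n} − 1)/(q^{−1} − 1), and where for n ≤ 2 the last term is interpreted as 0 (consistent with α_{n−2}^{(c)} = 0). -/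
open Polynomial Topology

/-- The weight `w(x) = ∏_{j=0}^∞ (1 + x⁴ q^{4j})⁻¹`. -/
noncomputable def qweight (q x : ℝ) : ℝ := ∏' j : ℕ, (1 + x ^ 4 * q ^ (4 * j))⁻¹

/-- A family of monic orthogonal polynomials on the lattice `±c qᶻ` with weight `qweight q`. -/
structure MonicOrthFamily (q c : ℝ) where
  P : ℕ → Polynomial ℝ
  γ : ℕ → ℝ
  monic : ∀ n, (P n).Monic
  deg : ∀ n, (P n).natDegree = n
  γ_pos : ∀ n, 0 < γ n
  abs_summable : ∀ n m : ℕ, Summable (fun k : ℤ =>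
    |((P n).eval (c * q ^ k) * (P m).eval (c * q ^ k) * qweight q (c * q ^ k)
      + (P n).eval (-(c * q ^ k)) * (P m).eval (-(c * q ^ k)) * qweight q (-(c * q ^ k)))
        * q ^ k|)
  orth : ∀ n m : ℕ,
    (∑' k : ℤ, ((P n).eval (c * q ^ k) * (P m).eval (c * q ^ k) * qweight q (c * q ^ k)
      + (P n).eval (-(c * q ^ k)) * (P m).eval (-(c * q ^ k)) * qweight q (-(c * q ^ k)))
        * q ^ k)
      = if n = m then γ n else 0

/-! ### The weight -/

theorem qweight_neg (q x : ℝ) : qweight q (-x) = qweight q x := by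
  simp [qweight, Even.neg_pow (show Even 4 by decide)]

theorem multipliable_inv_one_add_of_summable {u : ℕ → ℝ} (hu0 : ∀ j, 0 ≤ u j)
    (hu : Summable u) : Multipliable fun j => (1 + u j)⁻¹ := by
  have h : (fun j => (1 + u j)⁻¹) = fun j => 1 + -(u j / (1 + u j)) := by
    funext j
    have := hu0 j
    field_simp
    ring
  rw [h]
  refine multipliable_one_add_of_summable (Summable.of_nonneg_of_le (fun j => norm_nonneg _)
    (fun j => ?_) hu)
  have := hu0 j
  rw [norm_neg, Real.norm_of_nonneg (by positivity)]
  exact div_le_self this (by linarith)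

theorem qweight_mul_left {q : ℝ} (hq0 : 0 < q) (hq1 : q < 1) (x : ℝ) :
    qweight q (q * x) = (1 + x ^ 4) * qweight q x := by
  have hs : Summable fun j : ℕ => x ^ 4 * q ^ (4 * (j + 1)) := by
    refine Summable.mul_left _ ?_
    have h : (fun j : ℕ => q ^ (4 * (j + 1))) = fun j => q ^ 4 * (q ^ 4) ^ j := by
      funext j
      ring
    rw [h]
    exact (summable_geometric_of_lt_one (by positivity)
      (pow_lt_one₀ hq0.le hq1 (by norm_num))).mul_left _
  have hm := multipliable_inv_one_add_of_summable (fun j => by positivity) hs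
  have h := tprod_eq_zero_mul' (f := fun j : ℕ => (1 + x ^ 4 * q ^ (4 * j))⁻¹) hm
  have hshift : qweight q (q * x) = ∏' j : ℕ, (1 + x ^ 4 * q ^ (4 * (j + 1)))⁻¹ := by
    unfold qweight
    refine tprod_congr fun j => ?_
    congr 2
    ring
  have hx : (1 + x ^ 4) ≠ 0 := by positivity
  rw [hshift, qweight, h]
  simp only [mul_zero, pow_zero, mul_one]
  rw [mul_inv_cancel_left₀ hx]

/-! ### The q-difference quotient of a polynomial -/

/-- The polynomial `(f(ax) - f(x)) / x`. -/
noncomputable def qdiff (a : ℝ) (f : ℝ[X]) : ℝ[X] := divX (f.comp (C a * X) - f)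

theorem X_mul_qdiff (a : ℝ) (f : ℝ[X]) : X * qdiff a f = f.comp (C a * X) - f := by
  have h := divX_mul_X_add (f.comp (C a * X) - f)
  have h0 : (f.comp (C a * X) - f).coeff 0 = 0 := by
    simp [comp_C_mul_X_coeff]
  rw [h0, C_0, add_zero] at h
  rw [qdiff, mul_comm, h]

theorem coeff_qdiff (a : ℝ) (f : ℝ[X]) (k : ℕ) :
    (qdiff a f).coeff k = f.coeff (k + 1) * (a ^ (k + 1) - 1) := by
  rw [qdiff, coeff_divX, coeff_sub, comp_C_mul_X_coeff]
  ring

/-! ### The signed lattice sum -/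

/-- The summand of `signedSum`. -/
noncomputable def signedTerm (q c : ℝ) (f : ℝ[X]) (k : ℤ) : ℝ :=
  (f.eval (c * q ^ k) - f.eval (-(c * q ^ k))) * qweight q (c * q ^ k)

/-- The functional `f ↦ ∑ sgn(x) f(x) w(x)` over the lattice `x ∈ ±c qᶻ`. -/
noncomputable def signedSum (q c : ℝ) (hs : ∀ f, Summable (signedTerm q c f)) :
    ℝ[X] →ₗ[ℝ] ℝ where
  toFun f := ∑' k, signedTerm q c f k
  map_add' f g := by
    rw [← (hs f).tsum_add (hs g)]
    refine tsum_congr fun k => ?_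
    simp only [signedTerm, eval_add]
    ring
  map_smul' a f := by
    rw [RingHom.id_apply, smul_eq_mul, ← tsum_mul_left]
    refine tsum_congr fun k => ?_
    simp only [signedTerm, eval_smul, smul_eq_mul]
    ring

theorem signedSum_eq_zero_of_even {q c : ℝ} (hs : ∀ f, Summable (signedTerm q c f)) {f : ℝ[X]}
    (hf : ∀ x, f.eval (-x) = f.eval x) : signedSum q c hs f = 0 := by
  simp [signedSum, signedTerm, hf]

theorem signedSum_comp {q c : ℝ} (hq0 : 0 < q) (hq1 : q < 1)
    (hs : ∀ f, Summable (signedTerm q c f)) (f : ℝ[X]) :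
    signedSum q c hs (f.comp (C q⁻¹ * X)) = signedSum q c hs ((1 + X ^ 4) * f) := by
  change ∑' k, signedTerm q c _ k = ∑' k, signedTerm q c _ k
  rw [← (Equiv.addRight (1 : ℤ)).tsum_eq]
  refine tsum_congr fun k => ?_
  have hx : c * q ^ (k + 1) = q * (c * q ^ k) := by
    rw [zpow_add_one₀ hq0.ne']
    ring
  have hx' : q⁻¹ * (q * (c * q ^ k)) = c * q ^ k := inv_mul_cancel_left₀ hq0.ne' _
  simp only [signedTerm, Equiv.coe_addRight, hx, qweight_mul_left hq0 hq1, eval_comp, eval_mul,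
    eval_C, eval_X, eval_add, eval_one, eval_pow, mul_neg, hx']
  ring

theorem signedSum_X_mul_qdiff_mul {q c : ℝ} (hq0 : 0 < q) (hq1 : q < 1)
    (hs : ∀ f, Summable (signedTerm q c f)) (f g : ℝ[X]) :
    signedSum q c hs (X * (qdiff q⁻¹ f * g)) =
      signedSum q c hs (X * ((qdiff q g + X ^ 3 * g.comp (C q * X)) * f)) := by
  have hg : (g.comp (C q * X)).comp (C q⁻¹ * X) = g := by
    rw [comp_assoc, mul_comp, C_comp, X_comp, ← mul_assoc, ← C_mul, mul_inv_cancel₀ hq0.ne', C_1,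
      one_mul, comp_X]
  have h1 : X * (qdiff q⁻¹ f * g) = (f * g.comp (C q * X)).comp (C q⁻¹ * X) - f * g := by
    rw [mul_comp, hg, ← mul_assoc, X_mul_qdiff]
    ring
  have h2 : X * ((qdiff q g + X ^ 3 * g.comp (C q * X)) * f) =
      (1 + X ^ 4) * (f * g.comp (C q * X)) - f * g := by
    have : X * ((qdiff q g + X ^ 3 * g.comp (C q * X)) * f) =
      (X * qdiff q g + X ^ 4 * g.comp (C q * X)) * f := by ring
    rw [this, X_mul_qdiff]
    ring
  rw [h1, h2, map_sub, map_sub, signedSum_comp hq0 hq1]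

/-! ### Monic orthogonal families -/

namespace MonicOrthFamily

variable {q c : ℝ} (F : MonicOrthFamily q c)

theorem P_zero : F.P 0 = 1 := (F.monic 0).natDegree_eq_zero.mp (F.deg 0)

theorem coeff_self (n : ℕ) : (F.P n).coeff n = 1 := by
  have := F.monic n
  rwa [Monic, leadingCoeff, F.deg] at this

theorem coeff_of_lt {n k : ℕ} (h : n < k) : (F.P n).coeff k = 0 :=
  coeff_eq_zero_of_natDegree_lt (by rwa [F.deg])

theorem degree_sub_lt {N : ℕ} {f : ℝ[X]} (hf : f.degree < (N + 1 : ℕ)) :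
    (f - f.coeff N • F.P N).degree < N := by
  rw [degree_lt_iff_coeff_zero] at hf ⊢
  intro m hm
  rw [coeff_sub, coeff_smul, smul_eq_mul]
  rcases hm.eq_or_lt with rfl | hm
  · rw [F.coeff_self]
    ring
  · rw [F.coeff_of_lt hm, hf m hm]
    ring

theorem mem_of_degree_lt (S : Submodule ℝ ℝ[X]) {N : ℕ} (hS : ∀ j < N, F.P j ∈ S) {f : ℝ[X]}
    (hf : f.degree < N) : f ∈ S := by
  induction N generalizing f with
  | zero =>
    have : f = 0 := by simpa using hf
    exact this ▸ S.zero_mem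
  | succ N ih =>
    have h := S.add_mem (ih (fun j hj => hS j (by omega)) (F.degree_sub_lt hf))
      (S.smul_mem (f.coeff N) (hS N (by omega)))
    rwa [sub_add_cancel] at h

theorem signedTerm_X_mul (n m : ℕ) (k : ℤ) :
    signedTerm q c (X * (F.P n * F.P m)) k =
      c * (((F.P n).eval (c * q ^ k) * (F.P m).eval (c * q ^ k) * qweight q (c * q ^ k)
      + (F.P n).eval (-(c * q ^ k)) * (F.P m).eval (-(c * q ^ k)) * qweight q (-(c * q ^ k)))
        * q ^ k) := by
  simp only [signedTerm, eval_mul, eval_X, qweight_neg]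
  ring

theorem summable_signedTerm (F : MonicOrthFamily q c) (f : ℝ[X]) : Summable (signedTerm q c f) := by
  let S : Submodule ℝ ℝ[X] :=
    { carrier := {g | Summable (signedTerm q c (X * g))}
      zero_mem' := by
        refine summable_zero.congr fun k => ?_
        simp [signedTerm]
      add_mem' := by
        intro a b ha hb
        refine (Summable.add ha hb).congr fun k => ?_
        simp only [signedTerm, eval_mul, eval_add]
        ring
      smul_mem' := by
        intro r a ha
        refine (Summable.mul_left r ha).congr fun k => ?_
        simp only [signedTerm, eval_mul, eval_smul, smul_eq_mul]
        ring }
  have hS : ∀ j, F.P j ∈ S := by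
    intro j
    refine ((F.abs_summable j 0).of_abs.mul_left c).congr fun k => ?_
    rw [← F.signedTerm_X_mul, F.P_zero, mul_one]
  have hdiv : divX f ∈ S :=
    F.mem_of_degree_lt S (fun j _ => hS j) (degree_le_natDegree.trans_lt
      (Nat.cast_lt.mpr (Nat.lt_succ_self _)))
  refine Summable.congr hdiv fun k => ?_
  conv_rhs => rw [← divX_mul_X_add f]
  simp only [signedTerm, eval_add, eval_mul, eval_X, eval_C]
  ring

/-- The bilinear form `c ∑ f(x) g(x) w(x) |x|` over the lattice, as a function of `f * g`. -/
noncomputable def moment : ℝ[X] →ₗ[ℝ] ℝ :=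
  signedSum q c F.summable_signedTerm ∘ₗ LinearMap.mulLeft ℝ X

theorem moment_P_mul_P (n m : ℕ) :
    F.moment (F.P n * F.P m) = if n = m then c * F.γ n else 0 := by
  change ∑' k, signedTerm q c (X * (F.P n * F.P m)) k = _
  simp only [F.signedTerm_X_mul]
  rw [tsum_mul_left, F.orth, mul_ite, mul_zero]

theorem moment_eq_zero_of_odd {f : ℝ[X]} (hf : ∀ x, f.eval (-x) = -f.eval x) :
    F.moment f = 0 :=
  signedSum_eq_zero_of_even F.summable_signedTerm fun x => by simp [hf]

theorem moment_mul_P {n : ℕ} {f : ℝ[X]} (hf : f.degree < (n + 1 : ℕ)) :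
    F.moment (f * F.P n) = f.coeff n * (c * F.γ n) := by
  have hlow : F.moment ((f - f.coeff n • F.P n) * F.P n) = 0 := by
    refine F.mem_of_degree_lt (LinearMap.ker (F.moment ∘ₗ LinearMap.mulRight ℝ (F.P n)))
      (fun j hj => ?_) (F.degree_sub_lt hf)
    rw [LinearMap.mem_ker]
    exact (F.moment_P_mul_P j n).trans (if_neg hj.ne)
  rw [sub_mul, map_sub, smul_mul_assoc, map_smul, F.moment_P_mul_P, if_pos rfl, smul_eq_mul] at hlow
  linarith

theorem eq_zero_of_moment_mul_P (hc : c ≠ 0) {N : ℕ} {f : ℝ[X]} (hf : f.degree < N)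
    (h : ∀ j < N, F.moment (f * F.P j) = 0) : f = 0 := by
  induction N with
  | zero => simpa using hf
  | succ N ih =>
    have hN := F.moment_mul_P hf
    rw [h N (by omega), eq_comm, mul_eq_zero,
      or_iff_left (mul_ne_zero hc (F.γ_pos N).ne')] at hN
    refine ih ?_ fun j hj => h j (by omega)
    have := F.degree_sub_lt hf
    rwa [hN, zero_smul, sub_zero] at this

theorem P_one (hc : c ≠ 0) : F.P 1 = X := by
  have hP : F.P 1 = X + C ((F.P 1).coeff 0) := (F.monic 1).eq_X_add_C (F.deg 1)
  have h := F.moment_P_mul_P 1 0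
  have hX : F.moment X = 0 := F.moment_eq_zero_of_odd fun x => by simp
  have h1 : F.moment 1 = c * F.γ 0 := by simpa [F.P_zero] using F.moment_P_mul_P 0 0
  rw [F.P_zero, mul_one, if_neg one_ne_zero, hP, map_add, hX, zero_add, ← mul_one (C _),
    ← smul_eq_C_mul, map_smul, h1, smul_eq_mul, mul_eq_zero,
    or_iff_left (mul_ne_zero hc (F.γ_pos 0).ne')] at h
  rw [hP, h, C_0, add_zero]

theorem eval_neg (hc : c ≠ 0) {a : ℕ → ℝ}
    (hrec : ∀ n : ℕ, 1 ≤ n → ∀ x : ℝ,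
      x * (F.P n).eval x = (F.P (n + 1)).eval x + a n * (F.P (n - 1)).eval x) (n : ℕ) (x : ℝ) :
    (F.P n).eval (-x) = (-1) ^ n * (F.P n).eval x := by
  induction n using Nat.strong_induction_on with
  | _ n ih =>
    match n with
    | 0 => simp [F.P_zero]
    | 1 => simp [F.P_one hc]
    | n + 2 =>
      have h1 := hrec (n + 1) (by omega) x
      have h2 := hrec (n + 1) (by omega) (-x)
      rw [ih (n + 1) (by omega), Nat.add_sub_cancel, ih n (by omega)] at h2
      rw [Nat.add_sub_cancel] at h1
      linear_combination -h2 + (-1) ^ n * h1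

theorem moment_qdiff_mul (hq0 : 0 < q) (hq1 : q < 1) (f g : ℝ[X]) :
    F.moment (qdiff q⁻¹ f * g) =
      F.moment ((qdiff q g + X ^ 3 * g.comp (C q * X)) * f) :=
  signedSum_X_mul_qdiff_mul hq0 hq1 F.summable_signedTerm f g

theorem degree_qdiff_P_lt (a : ℝ) (n : ℕ) : (qdiff a (F.P n)).degree < n := by
  rw [degree_lt_iff_coeff_zero]
  intro m hm
  rw [coeff_qdiff, F.coeff_of_lt (by omega), zero_mul]

theorem moment_qdiff_P_mul_P_pred (a : ℝ) (n : ℕ) :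
    F.moment (qdiff a (F.P (n + 1)) * F.P n) = (a ^ (n + 1) - 1) * (c * F.γ n) := by
  rw [F.moment_mul_P (F.degree_qdiff_P_lt _ _), coeff_qdiff, F.coeff_self, one_mul]

theorem moment_qdiff_P_mul_P_of_le (hq0 : 0 < q) (hq1 : q < 1) {n j : ℕ} (h : j + 3 ≤ n) :
    F.moment (qdiff q⁻¹ (F.P n) * F.P j) = if j + 3 = n then q ^ j * (c * F.γ n) else 0 := by
  have hcoeff : ∀ m, j + 3 ≤ m → (qdiff q (F.P j) + X ^ 3 * (F.P j).comp (C q * X)).coeff m =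
      if j + 3 = m then q ^ j else 0 := by
    intro m hm
    obtain ⟨i, rfl⟩ : ∃ i, m = i + 3 := ⟨m - 3, by omega⟩
    rw [coeff_add, coeff_qdiff, F.coeff_of_lt (by omega), coeff_X_pow_mul, comp_C_mul_X_coeff]
    rcases (show j ≤ i by omega).eq_or_lt with rfl | hji
    · simp [F.coeff_self]
    · rw [F.coeff_of_lt hji, if_neg (by omega)]
      ring
  rw [F.moment_qdiff_mul hq0 hq1, F.moment_mul_P, hcoeff n h, ite_mul, zero_mul]
  rw [degree_lt_iff_coeff_zero]
  intro m hm
  rw [hcoeff m (by omega), if_neg (by omega)]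

theorem moment_qdiff_P_mul_P_of_eval_neg (hP : ∀ n x, (F.P n).eval (-x) = (-1) ^ n * (F.P n).eval x)
    (a : ℝ) (n : ℕ) : F.moment (qdiff a (F.P (n + 2)) * F.P n) = 0 := by
  have hq : (qdiff a (F.P (n + 2))).comp (-X) + C ((-1) ^ n) * qdiff a (F.P (n + 2)) = 0 := by
    refine (mul_eq_zero.mp (Polynomial.funext fun x => ?_)).resolve_left X_ne_zero
    have h := congrArg (eval x) (X_mul_qdiff a (F.P (n + 2)))
    have h' := congrArg (eval (-x)) (X_mul_qdiff a (F.P (n + 2)))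
    simp only [eval_mul, eval_X, eval_sub, eval_comp, eval_C, mul_neg, hP] at h h'
    simp only [eval_mul, eval_X, eval_add, eval_comp, eval_C, Polynomial.eval_neg, eval_zero]
    linear_combination -h' + (-1) ^ n * h
  refine F.moment_eq_zero_of_odd fun x => ?_
  have hx := congrArg (eval x) hq
  simp only [eval_mul, eval_X, eval_add, eval_comp, eval_C, Polynomial.eval_neg, eval_zero] at hx
  have hsq : ((-1 : ℝ) ^ n) * (-1) ^ n = 1 := by
    rw [← mul_pow]
    simp
  rw [eval_mul, eval_mul, hP]
  linear_combination (-1) ^ n * (F.P n).eval x * hx -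
    (qdiff a (F.P (n + 2))).eval x * (F.P n).eval x * hsq

/-- The expansion of the q-difference quotient of `P n` in the orthogonal family. -/
theorem qdiff_P (hq0 : 0 < q) (hq1 : q < 1) (hc : c ≠ 0)
    (hP : ∀ n x, (F.P n).eval (-x) = (-1) ^ n * (F.P n).eval x) (n : ℕ) :
    qdiff q⁻¹ (F.P (n + 1)) = (q⁻¹ ^ (n + 1) - 1) • F.P n +
      (if 2 ≤ n then q ^ (n - 2) * (F.γ (n + 1) / F.γ (n - 2)) else 0) • F.P (n - 2) := by
  set r := if 2 ≤ n then q ^ (n - 2) * (F.γ (n + 1) / F.γ (n - 2)) else 0 with hr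
  rw [← sub_eq_zero]
  refine F.eq_zero_of_moment_mul_P hc (N := n + 1) ?_ fun j hj => ?_
  · have hlt : ∀ j ≤ n, (F.P j).degree < (n + 1 : ℕ) := fun j hj => by
      rw [degree_lt_iff_coeff_zero]
      exact fun m hm => F.coeff_of_lt (by omega)
    rw [← mem_degreeLT]
    exact Submodule.sub_mem (degreeLT ℝ (n + 1)) (mem_degreeLT.mpr (F.degree_qdiff_P_lt _ _))
      (Submodule.add_mem _ (Submodule.smul_mem _ _ (mem_degreeLT.mpr (hlt n le_rfl)))
        (Submodule.smul_mem _ _ (mem_degreeLT.mpr (hlt (n - 2) (by omega)))))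
  · rw [sub_mul, add_mul, map_sub, map_add, smul_mul_assoc, smul_mul_assoc, map_smul, map_smul,
      F.moment_P_mul_P, F.moment_P_mul_P, smul_eq_mul, smul_eq_mul]
    obtain rfl | rfl | h : j = n ∨ n = j + 1 ∨ j + 2 ≤ n := by omega
    · rw [F.moment_qdiff_P_mul_P_pred, if_pos rfl]
      rcases le_or_gt 2 j with h | h
      · rw [if_neg (by omega)]
        ring
      · rw [hr, if_neg (by omega)]
        ring
    · rw [F.moment_qdiff_P_mul_P_of_eval_neg hP, if_neg (by omega)]
      rcases le_or_gt 2 (j + 1) with h | h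
      · rw [if_neg (by omega)]
        ring
      · rw [hr, if_neg (by omega)]
        ring
    · rw [F.moment_qdiff_P_mul_P_of_le hq0 hq1 (by omega), hr, if_pos (show 2 ≤ n by omega),
        if_neg (show n ≠ j by omega)]
      rcases h.eq_or_lt with rfl | h
      · have := (F.γ_pos j).ne'
        rw [if_pos rfl, Nat.add_sub_cancel, if_pos rfl]
        field_simp
        ring
      · rw [if_neg (by omega), if_neg (by omega)]
        ring

end MonicOrthFamily

theorem statement15 (q c : ℝ) (hq0 : 0 < q) (hq1 : q < 1) (hc1 : q < c) (hc2 : c ≤ 1)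
    (F : MonicOrthFamily q c) (α : ℤ → ℝ)
    -- α_k = 0 for k ≤ 0
    (hα0 : ∀ k : ℤ, k ≤ 0 → α k = 0)
    -- recurrence coefficients α_n = γ_n / γ_{n-1} for n ≥ 1
    (hα : ∀ n : ℕ, 1 ≤ n → α (n : ℤ) = F.γ n / F.γ (n - 1))
    -- three-term recurrence x P_n(x) = P_{n+1}(x) + α_n P_{n-1}(x)
    (hrec : ∀ n : ℕ, 1 ≤ n → ∀ x : ℝ,
      x * (F.P n).eval x = (F.P (n + 1)).eval x + α (n : ℤ) * (F.P (n - 1)).eval x) :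
    ∀ n : ℕ, 1 ≤ n → ∀ x : ℝ, x ≠ 0 →
      ((F.P n).eval (q⁻¹ * x) - (F.P n).eval x) / (x * (q⁻¹ - 1))
        = ((q ^ (-(n : ℤ)) - 1) / (q⁻¹ - 1)) * (F.P (n - 1)).eval x
          + (q ^ ((n : ℤ) - 3) / (q⁻¹ - 1)) * α (n : ℤ) * α ((n : ℤ) - 1) * α ((n : ℤ) - 2)
              * (F.P (n - 3)).eval x := by
  have hc : c ≠ 0 := (hq0.trans hc1).ne'
  intro n hn x hx
  obtain ⟨n, rfl⟩ : ∃ m, n = m + 1 := ⟨n - 1, by omega⟩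
  have hqi : q⁻¹ - 1 ≠ 0 := (sub_pos.mpr ((one_lt_inv₀ hq0).mpr hq1)).ne'
  have hP := F.eval_neg hc (a := fun n => α (n : ℤ)) hrec
  have hD := congrArg (eval x) (X_mul_qdiff q⁻¹ (F.P (n + 1)))
  rw [F.qdiff_P hq0 hq1 hc hP] at hD
  simp only [eval_mul, eval_X, eval_sub, eval_comp, eval_C, eval_add, eval_smul,
    smul_eq_mul] at hD
  have hz : q ^ (-((n + 1 : ℕ) : ℤ)) = q⁻¹ ^ (n + 1) := by
    rw [zpow_neg, zpow_natCast, inv_pow]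
  have hr : (if 2 ≤ n then q ^ (n - 2) * (F.γ (n + 1) / F.γ (n - 2)) else 0) =
      q ^ (((n + 1 : ℕ) : ℤ) - 3) * (α ((n + 1 : ℕ) : ℤ) * α (((n + 1 : ℕ) : ℤ) - 1) *
        α (((n + 1 : ℕ) : ℤ) - 2)) := by
    split_ifs with h
    · obtain ⟨m, rfl⟩ : ∃ m, n = m + 2 := ⟨n - 2, by omega⟩
      have e1 : ((m + 2 + 1 : ℕ) : ℤ) - 1 = ((m + 2 : ℕ) : ℤ) := by push_cast; ring
      have e2 : ((m + 2 + 1 : ℕ) : ℤ) - 2 = ((m + 1 : ℕ) : ℤ) := by push_cast; ring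
      have e3 : ((m + 2 + 1 : ℕ) : ℤ) - 3 = (m : ℤ) := by push_cast; ring
      rw [e1, e2, e3, hα _ (by omega), hα _ (by omega), hα _ (by omega), zpow_natCast]
      have h0 := (F.γ_pos m).ne'
      have h1 := (F.γ_pos (m + 1)).ne'
      have h2 := (F.γ_pos (m + 2)).ne'
      simp only [Nat.add_sub_cancel, show m + 2 - 1 = m + 1 by omega]
      field_simp
    · rw [hα0 (((n + 1 : ℕ) : ℤ) - 2) (by omega)]
      ring
  rw [hr] at hD
  rw [← hD, hz, Nat.add_sub_cancel, show n + 1 - 3 = n - 2 by omega]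
  field_simp
end

section
/- The set of real sequences (α_n)_{n≥0} with α_0 = 0, α_n > 0 for all n ≥ 1, and satisfying α_n ( α_{n+1} + q^{n−1} α_n + q^{−2} α_{n−1} − q^{2n−3} α_{n+1} α_n α_{n−1} ) = (q^{−n} − 1) q^{1−n} for all n ≥ 1, is infinite. -/
open Filter Topology

/-- The pairs `(z_{k+1}, u_{k+1})` of the rescaled recurrence with `α_n = q^{1-n} z_n` and
`u_n = 1 - z_n z_{n-1}`, started from `z_1 = x`, `u_1 = 1`. -/
noncomputable def orbit (q x : ℝ) : ℕ → ℝ × ℝ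
  | 0 => (x, 1)
  | k + 1 =>
    ((1 - q ^ (k + 1) * (1 + (orbit q x k).1 ^ 2) / (orbit q x k).2) / (orbit q x k).1,
      q ^ (k + 1) * (1 + (orbit q x k).1 ^ 2) / (orbit q x k).2)

noncomputable def orbitZ (q x : ℝ) (k : ℕ) : ℝ := (orbit q x k).1

noncomputable def orbitU (q x : ℝ) (k : ℕ) : ℝ := (orbit q x k).2

lemma orbitZ_zero (q x : ℝ) : orbitZ q x 0 = x := rfl

lemma orbitU_zero (q x : ℝ) : orbitU q x 0 = 1 := rfl

lemma orbitU_succ (q x : ℝ) (k : ℕ) :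
    orbitU q x (k + 1) = q ^ (k + 1) * (1 + orbitZ q x k ^ 2) / orbitU q x k := rfl

lemma orbitZ_succ (q x : ℝ) (k : ℕ) :
    orbitZ q x (k + 1) = (1 - orbitU q x (k + 1)) / orbitZ q x k := rfl

lemma orbitU_pos {q : ℝ} (hq : 0 < q) (x : ℝ) (k : ℕ) : 0 < orbitU q x k := by
  induction k with
  | zero => rw [orbitU_zero]; exact one_pos
  | succ k ih => rw [orbitU_succ]; positivity

lemma orbitU_mul_succ {q : ℝ} (hq : 0 < q) (x : ℝ) (k : ℕ) :
    orbitU q x k * orbitU q x (k + 1) = q ^ (k + 1) * (1 + orbitZ q x k ^ 2) := by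
  rw [orbitU_succ, mul_div_cancel₀ _ (orbitU_pos hq x k).ne']

lemma orbitZ_mul_succ {q x : ℝ} {k : ℕ} (h : orbitZ q x k ≠ 0) :
    orbitZ q x k * orbitZ q x (k + 1) = 1 - orbitU q x (k + 1) := by
  rw [orbitZ_succ, mul_div_cancel₀ _ h]

lemma orbitU_add_two {q : ℝ} (hq : 0 < q) (x : ℝ) (k : ℕ) :
    orbitU q x (k + 2) * (1 + orbitZ q x k ^ 2)
      = q * orbitU q x k * (1 + orbitZ q x (k + 1) ^ 2) := by
  have h1 := orbitU_mul_succ hq x k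
  have h2 := orbitU_mul_succ hq x (k + 1)
  have h3 := (orbitU_pos hq x (k + 1)).ne'
  have h4 : q ^ (k + 1) ≠ 0 := by positivity
  apply mul_left_cancel₀ (mul_ne_zero h3 h4)
  rw [pow_succ q (k + 1)] at h2
  linear_combination q ^ (k + 1) * (1 + orbitZ q x k ^ 2) * h2
    - q ^ (k + 1) * q * (1 + orbitZ q x (k + 1) ^ 2) * h1

lemma continuousAt_orbit {q : ℝ} (hq : 0 < q) (x₀ : ℝ) (k : ℕ)
    (h : ∀ j < k, orbitZ q x₀ j ≠ 0) :
    ContinuousAt (fun x => orbitZ q x k) x₀ ∧ ContinuousAt (fun x => orbitU q x k) x₀ := by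
  induction k with
  | zero => exact ⟨continuousAt_id, continuousAt_const⟩
  | succ k ih =>
    obtain ⟨hz, hu⟩ := ih fun j hj => h j (by omega)
    have hU : ContinuousAt (fun x => orbitU q x (k + 1)) x₀ := by
      simp only [orbitU_succ]
      exact ((hz.pow 2).const_add 1 |>.const_mul _).div hu (orbitU_pos hq x₀ k).ne'
    refine ⟨?_, hU⟩
    simp only [orbitZ_succ]
    exact (continuousAt_const.sub hU).div hz (h k (by omega))

/-! ### Initial values whose orbit is balanced at a given time -/

lemma exists_last_eq_of_le {f : ℝ → ℝ} {a b η : ℝ} (hab : a ≤ b)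
    (hf : ContinuousOn f (Set.Icc a b)) (ha : f a ≤ η) (hb : η ≤ f b) :
    ∃ c ∈ Set.Icc a b, f c = η ∧ ∀ t ∈ Set.Icc c b, η ≤ f t := by
  have hcomp : IsCompact (Set.Icc a b ∩ f ⁻¹' {η}) :=
    isCompact_Icc.of_isClosed_subset
      (hf.preimage_isClosed_of_isClosed isClosed_Icc isClosed_singleton) Set.inter_subset_left
  obtain ⟨y, hy, hfy⟩ := intermediate_value_Icc hab hf ⟨ha, hb⟩
  obtain ⟨c, ⟨hc, hfc⟩, hmax⟩ := hcomp.exists_isGreatest ⟨y, hy, hfy⟩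
  refine ⟨c, hc, hfc, fun t ht => ?_⟩
  by_contra! hlt
  obtain ⟨s, hs, hfs⟩ := intermediate_value_Icc ht.2
    (hf.mono (Set.Icc_subset_Icc (hc.1.trans ht.1) le_rfl)) ⟨hlt.le, hb⟩
  have h1 : s ≤ c := hmax ⟨⟨hc.1.trans (ht.1.trans hs.1), hs.2⟩, hfs⟩
  have h2 : t = c := le_antisymm (hs.1.trans h1) ht.1
  rw [h2] at hlt
  exact hlt.ne hfc

lemma exists_last_eq {f : ℝ → ℝ} {a b η : ℝ} (hf : ContinuousOn f (Set.uIcc a b))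
    (ha : f a ≤ η) (hb : η ≤ f b) :
    ∃ c ∈ Set.uIcc a b, f c = η ∧ ∀ t ∈ Set.uIcc b c, η ≤ f t := by
  rcases le_total a b with hab | hab
  · rw [Set.uIcc_of_le hab] at hf ⊢
    obtain ⟨c, hc, hfc, h⟩ := exists_last_eq_of_le hab hf ha hb
    refine ⟨c, hc, hfc, fun t ht => h t ?_⟩
    rwa [Set.uIcc_of_ge hc.2] at ht
  · rw [Set.uIcc_of_ge hab] at hf ⊢
    have hg : ContinuousOn (fun t => f (-t)) (Set.Icc (-a) (-b)) :=
      hf.comp continuousOn_neg fun t ht => ⟨by linarith [ht.2], by linarith [ht.1]⟩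
    obtain ⟨c, hc, hfc, h⟩ := exists_last_eq_of_le (neg_le_neg hab) hg
      (by simpa using ha) (by simpa using hb)
    have hbc : b ≤ -c := by linarith [hc.2]
    refine ⟨-c, ⟨hbc, by linarith [hc.1]⟩, hfc, fun t ht => ?_⟩
    rw [Set.uIcc_of_le hbc] at ht
    simpa using h (-t) ⟨by linarith [ht.2], by linarith [ht.1]⟩

lemma exists_segment {q : ℝ} (hq0 : 0 < q) (hq1 : q < 1) (N : ℕ) (K : ℝ) :
    ∃ a b : ℝ, (∀ t ∈ Set.uIcc a b, ∀ j ≤ N, 0 < orbitZ q t j) ∧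
      orbitZ q a (N + 1) ≤ 0 ∧ K ≤ orbitZ q b (N + 1) := by
  induction N generalizing K with
  | zero =>
    have hx : 0 < (1 - q) / (|K| + 1) := div_pos (by linarith) (by positivity)
    have hx' : (1 - q) / (|K| + 1) * (|K| + 1) = 1 - q := div_mul_cancel₀ _ (by positivity)
    have hx1 : (1 - q) / (|K| + 1) ≤ 1 := by
      rw [div_le_one (by positivity)]; linarith [abs_nonneg K]
    set x := (1 - q) / (|K| + 1)
    refine ⟨1 / q, x, fun t ht j hj => ?_, ?_, ?_⟩
    · obtain rfl : j = 0 := by omega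
      rw [orbitZ_zero]
      exact (lt_min (by positivity) hx).trans_le ht.1
    · rw [orbitZ_succ, orbitU_succ, orbitU_zero, orbitZ_zero]
      apply div_nonpos_of_nonpos_of_nonneg _ (by positivity)
      have h1 : q * (1 / q) = 1 := mul_one_div_cancel hq0.ne'
      have h2 : 1 ≤ 1 / q := by rw [le_div_iff₀ hq0]; linarith
      simp only [zero_add, pow_one, div_one]
      nlinarith
    · rw [orbitZ_succ, orbitU_succ, orbitU_zero, orbitZ_zero, le_div_iff₀ hx]
      simp only [zero_add, pow_one, div_one]
      nlinarith [le_abs_self K, mul_nonneg hx.le (sub_nonneg.2 hx1),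
        mul_nonneg hx.le (sub_nonneg.2 (le_abs_self K)),
        mul_nonneg (sq_nonneg x) (sub_nonneg.2 hq1.le)]
  | succ N ih =>
    obtain ⟨a, b, hpos, ha, hb⟩ := ih ((1 / q) ^ (N + 2))
    have hcz : ∀ k ≤ N + 1, ContinuousOn (fun t => orbitZ q t k) (Set.uIcc a b) :=
      fun k hk t ht => (continuousAt_orbit hq0 t k
        fun j hj => (hpos t ht j (by omega)).ne').1.continuousWithinAt
    obtain ⟨B, hB⟩ := isCompact_uIcc.bddAbove_image (hcz N (by omega))
    have hBz : ∀ t ∈ Set.uIcc a b, orbitZ q t N ≤ B := fun t ht => hB ⟨t, ht, rfl⟩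
    have hB0 : 0 < B := (hpos b Set.right_mem_uIcc N le_rfl).trans_le (hBz b Set.right_mem_uIcc)
    have hη : 0 < (1 - q) / (2 * (1 + B + |K|)) := div_pos (by linarith) (by positivity)
    have hη' : (1 - q) / (2 * (1 + B + |K|)) * (2 * (1 + B + |K|)) = 1 - q :=
      div_mul_cancel₀ _ (by positivity)
    have hη1 : (1 - q) / (2 * (1 + B + |K|)) ≤ 1 := by
      rw [div_le_one (by positivity)]; linarith [abs_nonneg K]
    set η := (1 - q) / (2 * (1 + B + |K|))
    have hqi : 1 ≤ 1 / q := by rw [le_div_iff₀ hq0]; linarith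
    have hK1 : 1 ≤ (1 / q) ^ (N + 2) := one_le_pow₀ hqi
    obtain ⟨c, hc, hfc, hge⟩ := exists_last_eq (hcz (N + 1) le_rfl) (ha.trans hη.le)
      (hη1.trans (hK1.trans hb))
    have hsub : Set.uIcc b c ⊆ Set.uIcc a b := Set.uIcc_subset_uIcc Set.right_mem_uIcc hc
    have hu (t : ℝ) (ht : t ∈ Set.uIcc a b) :=
      orbitZ_mul_succ (hpos t ht N le_rfl).ne'
    refine ⟨b, c, fun t ht j hj => ?_, ?_, ?_⟩
    · rcases Nat.lt_or_ge N j with h | h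
      · obtain rfl : j = N + 1 := by omega
        exact hη.trans_le (hge t ht)
      · exact hpos t (hsub ht) j h
    · have hzb : 0 < orbitZ q b (N + 1) := by linarith
      have hub := hu b Set.right_mem_uIcc
      have hzz := mul_pos (hpos b Set.right_mem_uIcc N le_rfl) hzb
      rw [orbitZ_succ q b (N + 1)]
      apply div_nonpos_of_nonpos_of_nonneg _ hzb.le
      rw [orbitU_succ, sub_nonpos, le_div_iff₀ (orbitU_pos hq0 b _)]
      have hqK : q ^ (N + 2) * (1 / q) ^ (N + 2) = 1 := by
        rw [← mul_pow, mul_one_div_cancel hq0.ne', one_pow]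
      have hsq : orbitZ q b (N + 1) ≤ orbitZ q b (N + 1) ^ 2 := by nlinarith
      have hqp : 0 < q ^ (N + 2) := by positivity
      have h1 : q ^ (N + 2) * (1 / q) ^ (N + 2) ≤ q ^ (N + 2) * orbitZ q b (N + 1) ^ 2 :=
        mul_le_mul_of_nonneg_left (hb.trans hsq) hqp.le
      change 1 * orbitU q b (N + 1) ≤ q ^ (N + 2) * (1 + orbitZ q b (N + 1) ^ 2)
      linarith
    · have huc := hu c hc
      rw [hfc] at huc
      rw [orbitZ_succ q c (N + 1), hfc, le_div_iff₀ hη]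
      have hqp : q ^ (N + 2) ≤ q := pow_le_of_le_one hq0.le hq1.le (by omega)
      have hzB := mul_le_mul_of_nonneg_right (hBz c hc) hη.le
      have hUb : orbitU q c (N + 2) ≤ (1 + q) / 2 := by
        rw [orbitU_succ, div_le_iff₀ (orbitU_pos hq0 c _), hfc]
        have h1 : q ^ (N + 2) * (1 + η ^ 2) ≤ q * (1 + η ^ 2) :=
          mul_le_mul_of_nonneg_right hqp (by positivity)
        have h2 : η ^ 2 ≤ η := by nlinarith
        have h3 : η * |K| ≥ 0 := by positivity
        have h4 : (1 + q) / 2 * (1 - B * η) ≤ (1 + q) / 2 * orbitU q c (N + 1) :=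
          mul_le_mul_of_nonneg_left (by linarith) (by linarith)
        change q ^ (N + 2) * (1 + η ^ 2) ≤ _
        nlinarith [mul_nonneg hB0.le hη.le]
      nlinarith [mul_le_mul_of_nonneg_right (le_abs_self K) hη.le, mul_nonneg hB0.le hη.le]

lemma exists_balanced {q : ℝ} (hq0 : 0 < q) (hq1 : q < 1) (N : ℕ) :
    ∃ x : ℝ, (∀ j ≤ N + 1, 0 < orbitZ q x j) ∧ orbitZ q x N = orbitZ q x (N + 1) := by
  obtain ⟨a, b, hpos, ha, hb⟩ := exists_segment hq0 hq1 N 1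
  have hcz : ∀ k ≤ N + 1, ContinuousOn (fun t => orbitZ q t k) (Set.uIcc a b) :=
    fun k hk t ht => (continuousAt_orbit hq0 t k
      fun j hj => (hpos t ht j (by omega)).ne').1.continuousWithinAt
  have hzb := hpos b Set.right_mem_uIcc N le_rfl
  have hlt : orbitZ q b N ≤ orbitZ q b (N + 1) := by
    have h1 := orbitZ_mul_succ hzb.ne'
    have h2 := orbitU_pos hq0 b (N + 1)
    nlinarith
  obtain ⟨x, hx, hfx⟩ := intermediate_value_uIcc
    ((hcz (N + 1) le_rfl).sub (hcz N (by omega)))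
    (show (0 : ℝ) ∈ _ from Set.mem_uIcc_of_le
      (sub_nonpos.2 (ha.trans (hpos a Set.left_mem_uIcc N le_rfl).le)) (sub_nonneg.2 hlt))
  have heq : orbitZ q x N = orbitZ q x (N + 1) := (sub_eq_zero.1 hfx).symm
  refine ⟨x, fun j hj => ?_, heq⟩
  rcases Nat.lt_or_ge N j with h | h
  · obtain rfl : j = N + 1 := by omega
    exact heq ▸ hpos x hx N le_rfl
  · exact hpos x hx j h

/-! ### Smallness of `u` at a balanced time -/

lemma orbitU_le_iff {q x : ℝ} {k : ℕ} (h0 : 0 < orbitZ q x k) (h1 : 0 < orbitZ q x (k + 1)) :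
    orbitU q x (k + 1) ≤ orbitU q x (k + 2) ↔ orbitZ q x (k + 2) ≤ orbitZ q x k := by
  have e1 := orbitZ_mul_succ h0.ne'
  have e2 := orbitZ_mul_succ h1.ne'
  rw [← mul_le_mul_iff_right₀ h1 (b := orbitZ q x _)]
  constructor <;> intro h <;> linarith

lemma orbitU_ge_iff {q x : ℝ} {k : ℕ} (h0 : 0 < orbitZ q x k) (h1 : 0 < orbitZ q x (k + 1)) :
    orbitU q x (k + 2) ≤ orbitU q x (k + 1) ↔ orbitZ q x k ≤ orbitZ q x (k + 2) := by
  have e1 := orbitZ_mul_succ h0.ne'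
  have e2 := orbitZ_mul_succ h1.ne'
  rw [← mul_le_mul_iff_right₀ h1 (b := orbitZ q x _)]
  constructor <;> intro h <;> linarith

lemma orbitU_add_two_le {q x : ℝ} (hq : 0 < q) {k : ℕ} (h1 : 0 < orbitZ q x (k + 1))
    (h : orbitZ q x (k + 1) ≤ orbitZ q x k) : orbitU q x (k + 2) ≤ q * orbitU q x k := by
  have e := orbitU_add_two hq x k
  have hu := orbitU_pos hq x k
  have h2 : orbitZ q x (k + 1) ^ 2 ≤ orbitZ q x k ^ 2 := pow_le_pow_left₀ h1.le h 2
  refine le_of_mul_le_mul_right ?_ (show 0 < 1 + orbitZ q x k ^ 2 by positivity)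
  rw [e]
  gcongr

lemma le_orbitU_add_two {q x : ℝ} (hq : 0 < q) {k : ℕ} (h0 : 0 < orbitZ q x k)
    (h : orbitZ q x k ≤ orbitZ q x (k + 1)) : q * orbitU q x k ≤ orbitU q x (k + 2) := by
  have e := orbitU_add_two hq x k
  have hu := orbitU_pos hq x k
  refine le_of_mul_le_mul_right ?_ (show 0 < 1 + orbitZ q x k ^ 2 by positivity)
  rw [e]
  gcongr

lemma orbitU_le_pow {q x : ℝ} (hq0 : 0 < q) (hq1 : q < 1) (k : ℕ)
    (hpos : ∀ j ≤ k + 1, 0 < orbitZ q x j)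
    (hu : orbitU q x (k + 2) ≤ q * orbitU q x (k + 1))
    (hz : orbitZ q x k ≤ orbitZ q x (k + 1)) :
    orbitU q x (k + 1) ≤ q ^ ((k + 1) / 2) := by
  induction k using Nat.twoStepInduction with
  | zero =>
    have h0 := hpos 0 (by omega)
    have h := mul_pos h0 (hpos 1 (by omega))
    have e := orbitZ_mul_succ h0.ne'
    simp only [zero_add] at e ⊢
    norm_num
    linarith
  | one =>
    have h1 := le_orbitU_add_two hq0 (hpos 1 (by omega)) hz
    have h2 : orbitU q x 1 ≤ orbitU q x 2 :=
      le_of_mul_le_mul_left (h1.trans hu) hq0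
    have h3 := (orbitU_le_iff (hpos 0 (by omega)) (hpos 1 (by omega))).1 h2
    have h4 := orbitU_add_two_le hq0 (hpos 1 (by omega)) (hz.trans h3)
    simpa [orbitU_zero] using h4
  | more k ih _ =>
    have h1 := le_orbitU_add_two hq0 (hpos (k + 2) (by omega)) hz
    have h2 : orbitU q x (k + 2) ≤ orbitU q x (k + 3) :=
      le_of_mul_le_mul_left (h1.trans hu) hq0
    have h3 := (orbitU_le_iff (hpos (k + 1) (by omega)) (hpos (k + 2) (by omega))).1 h2
    have h4 := orbitU_add_two_le hq0 (hpos (k + 2) (by omega)) (hz.trans h3)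
    have h5 : orbitU q x (k + 2) ≤ q * orbitU q x (k + 1) := h2.trans h4
    have h6 : orbitU q x (k + 2) ≤ orbitU q x (k + 1) := by
      nlinarith [orbitU_pos hq0 x (k + 1)]
    have h7 := (orbitU_ge_iff (hpos k (by omega)) (hpos (k + 1) (by omega))).1 h6
    have h8 := ih (fun j hj => hpos j (by omega)) h5 (h7.trans (hz.trans h3))
    have e : (k + 2 + 1) / 2 = (k + 1) / 2 + 1 := by omega
    rw [e, pow_succ']
    exact h4.trans (mul_le_mul_of_nonneg_left h8 hq0.le)

lemma orbitU_le_of_balanced {q x : ℝ} (hq0 : 0 < q) (hq1 : q < 1) (m : ℕ)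
    (hpos : ∀ j ≤ 2 * m + 3, 0 < orbitZ q x j)
    (hbal : orbitZ q x (2 * m + 2) = orbitZ q x (2 * m + 3)) :
    orbitU q x (2 * m + 2) ≤ 2 * q ^ m ∧ orbitU q x (2 * m + 3) ≤ 2 * q ^ m := by
  have hqm : 0 < q ^ m := by positivity
  have hU2 := orbitU_pos hq0 x (2 * m + 2)
  have hU1 := orbitU_pos hq0 x (2 * m + 1)
  rcases le_or_gt (orbitU q x (2 * m + 3)) (q * orbitU q x (2 * m + 2)) with h | h
  · have h1 : orbitU q x (2 * m + 3) ≤ orbitU q x (2 * m + 2) := by nlinarith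
    have h2 := (orbitU_ge_iff (hpos (2 * m + 1) (by omega)) (hpos (2 * m + 2) (by omega))).1 h1
    have h3 := orbitU_le_pow hq0 hq1 (2 * m + 1) (fun j hj => hpos j (by omega)) h
      (h2.trans hbal.ge)
    have e : (2 * m + 1 + 1) / 2 = m + 1 := by omega
    rw [e, pow_succ] at h3
    have h4 : orbitU q x (2 * m + 2) ≤ 2 * q ^ m := h3.trans (by nlinarith)
    exact ⟨h4, h1.trans h4⟩
  rcases le_or_gt (orbitU q x (2 * m + 2)) (orbitU q x (2 * m + 3)) with h' | h'
  · have h1 := (orbitU_le_iff (hpos (2 * m + 1) (by omega)) (hpos (2 * m + 2) (by omega))).1 h'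
    have h2 := orbitU_add_two_le hq0 (hpos (2 * m + 2) (by omega)) (hbal.le.trans h1)
    have h3 : orbitU q x (2 * m + 2) ≤ q * orbitU q x (2 * m + 1) := h'.trans h2
    have h4 : orbitU q x (2 * m + 2) ≤ orbitU q x (2 * m + 1) := by nlinarith
    have h5 := (orbitU_ge_iff (hpos (2 * m) (by omega)) (hpos (2 * m + 1) (by omega))).1 h4
    have h6 := orbitU_le_pow hq0 hq1 (2 * m) (fun j hj => hpos j (by omega)) h3
      (h5.trans (hbal.le.trans h1))
    have e : (2 * m + 1) / 2 = m := by omega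
    rw [e] at h6
    have h7 : orbitU q x (2 * m + 3) ≤ 2 * q ^ m := h2.trans (by nlinarith)
    exact ⟨h'.trans h7, h7⟩
  · have h1 := orbitU_mul_succ hq0 x (2 * m + 2)
    have h2 := orbitZ_mul_succ (hpos (2 * m + 2) (by omega)).ne'
    rw [← hbal] at h2
    have h3 : orbitZ q x (2 * m + 2) ^ 2 ≤ 1 := by
      linarith [orbitU_pos hq0 x (2 * m + 2 + 1)]
    have h4 : q ^ (2 * m + 2 + 1) = q * (q ^ (m + 1)) ^ 2 := by ring
    have h5 : q * orbitU q x (2 * m + 2) ^ 2 ≤ q * (2 * (q ^ (m + 1)) ^ 2) := by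
      rw [h4] at h1
      have : q * (q ^ (m + 1)) ^ 2 * (1 + orbitZ q x (2 * m + 2) ^ 2)
          ≤ q * (q ^ (m + 1)) ^ 2 * 2 :=
        mul_le_mul_of_nonneg_left (by linarith) (by positivity)
      nlinarith
    have h6 := le_of_mul_le_mul_left h5 hq0
    have h7 : q ^ (m + 1) ≤ q ^ m := pow_le_pow_of_le_one hq0.le hq1.le (by omega)
    have h8 : 0 < q ^ (m + 1) := by positivity
    have h9 : orbitU q x (2 * m + 2) ≤ 2 * q ^ m :=
      (sq_le_sq₀ hU2.le (by positivity)).1 (by nlinarith)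
    exact ⟨h9, h'.le.trans h9⟩

/-! ### A trapping region -/

/-- The orbit has entered the trapping region at time `k`. -/
def Trapped (q x : ℝ) (k : ℕ) : Prop :=
  |orbitZ q x k - 1| ≤ (1 - q) / 8 - 8 / (1 - q) * (orbitU q x k + orbitU q x (k + 1)) ∧
  |orbitZ q x (k + 1) - 1| ≤ (1 - q) / 8 - 8 / (1 - q) * (orbitU q x k + orbitU q x (k + 1))

lemma orbitU_add_two_le_of_near_one {q x : ℝ} (hq0 : 0 < q) (hq1 : q < 1) {k : ℕ}
    (h0 : |orbitZ q x k - 1| ≤ (1 - q) / 8) (h1 : |orbitZ q x (k + 1) - 1| ≤ (1 - q) / 8) :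
    orbitU q x (k + 2) ≤ (1 + q) / 2 * orbitU q x k := by
  have e := orbitU_add_two hq0 x k
  have hu := orbitU_pos hq0 x k
  rw [abs_le] at h0 h1
  set z := orbitZ q x k
  set w := orbitZ q x (k + 1)
  set β := (1 - q) / 8 with hβ
  have hβ0 : 0 < β := by rw [hβ]; linarith
  have hβ1 : β ≤ 1 / 8 := by rw [hβ]; linarith
  have hz : (1 - β) ^ 2 ≤ z ^ 2 := pow_le_pow_left₀ (by linarith) (by linarith) 2
  have hw : w ^ 2 ≤ (1 + β) ^ 2 := pow_le_pow_left₀ (by linarith) (by linarith) 2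
  have hzw : 1 + w ^ 2 ≤ (1 + 4 * β) * (1 + z ^ 2) := by
    have : 0 ≤ β * (1 - β) ^ 2 := by positivity
    nlinarith
  have hqβ : q * (1 + 4 * β) ≤ (1 + q) / 2 := by rw [hβ]; nlinarith
  refine le_of_mul_le_mul_right ?_ (show 0 < 1 + z ^ 2 by positivity)
  calc orbitU q x (k + 2) * (1 + z ^ 2) = q * orbitU q x k * (1 + w ^ 2) := e
    _ ≤ q * orbitU q x k * ((1 + 4 * β) * (1 + z ^ 2)) := by gcongr
    _ = q * (1 + 4 * β) * (orbitU q x k * (1 + z ^ 2)) := by ring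
    _ ≤ (1 + q) / 2 * (orbitU q x k * (1 + z ^ 2)) := by gcongr
    _ = _ := by ring

lemma abs_orbitZ_add_two_sub_le {q x : ℝ} (hq0 : 0 < q) {k : ℕ} {s : ℝ}
    (hz : 0 < orbitZ q x k) (hz2 : orbitZ q x k ≤ 2) (hw : 0 < orbitZ q x (k + 1))
    (hs : s ≤ 1 / 2)
    (h1 : orbitU q x (k + 1) ≤ s) (h2 : orbitU q x (k + 2) ≤ s) :
    |orbitZ q x (k + 2) - orbitZ q x k| ≤ 4 * s := by
  have e1 := orbitZ_mul_succ hz.ne'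
  have e2 := orbitZ_mul_succ hw.ne'
  have hu1 := orbitU_pos hq0 x (k + 1)
  have hu2 := orbitU_pos hq0 x (k + 2)
  set d := orbitZ q x (k + 2) - orbitZ q x k with hd
  have e3 : d * (1 - orbitU q x (k + 1))
      = orbitZ q x k * (orbitU q x (k + 1) - orbitU q x (k + 2)) := by
    rw [← e1]
    linear_combination orbitZ q x k * e2 - orbitZ q x k * e1
  have h3 : |d| * (1 - orbitU q x (k + 1)) ≤ 2 * s := by
    have h4 : |d * (1 - orbitU q x (k + 1))| = |d| * (1 - orbitU q x (k + 1)) := by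
      rw [abs_mul, abs_of_pos (show 0 < 1 - orbitU q x (k + 1) by linarith)]
    rw [← h4, e3, abs_mul, abs_of_pos hz]
    have h5 : |orbitU q x (k + 1) - orbitU q x (k + 2)| ≤ s := by
      rw [abs_le]; constructor <;> linarith
    exact mul_le_mul hz2 h5 (abs_nonneg _) (by norm_num)
  nlinarith [abs_nonneg d]

lemma Trapped.pos {q x : ℝ} (hq0 : 0 < q) (hq1 : q < 1) {k : ℕ} (h : Trapped q x k) :
    0 < orbitZ q x k ∧ 0 < orbitZ q x (k + 1) := by
  have hS := add_pos (orbitU_pos hq0 x k) (orbitU_pos hq0 x (k + 1))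
  have hC : 0 < 8 / (1 - q) := div_pos (by norm_num) (by linarith)
  have hCS := mul_pos hC hS
  constructor
  · linarith [(abs_le.1 h.1).1]
  · linarith [(abs_le.1 h.2).1]

lemma Trapped.add_two {q x : ℝ} (hq0 : 0 < q) (hq1 : q < 1) {k : ℕ} (h : Trapped q x k) :
    Trapped q x (k + 2) := by
  obtain ⟨hz, hw⟩ := h.pos hq0 hq1
  obtain ⟨h0, h1⟩ := h
  have hu0 := orbitU_pos hq0 x k
  have hu1 := orbitU_pos hq0 x (k + 1)
  set S := orbitU q x k + orbitU q x (k + 1) with hS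
  have hS0 : 0 < S := by positivity
  have hC : 8 / (1 - q) * (1 - q) = 8 := div_mul_cancel₀ _ (by linarith)
  have hC8 : 8 ≤ 8 / (1 - q) := by rw [le_div_iff₀ (by linarith)]; linarith
  have hu2 := orbitU_pos hq0 x (k + 2)
  unfold Trapped
  set C := 8 / (1 - q)
  have hCS : 0 < C * S := by positivity
  have hS8 : 8 * S ≤ (1 - q) / 8 := by nlinarith [abs_nonneg (orbitZ q x k - 1)]
  have hU2 := orbitU_add_two_le_of_near_one hq0 hq1 (h0.trans (by linarith))
    (h1.trans (by linarith))
  have hU2' : orbitU q x (k + 2) ≤ orbitU q x k := by nlinarith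
  have hz2 := abs_le.1 h0
  have hw2 := abs_le.1 h1
  have d2 := abs_orbitZ_add_two_sub_le hq0 (s := S) hz (by linarith) hw (by linarith)
    (by linarith) (by linarith)
  have t2 := abs_sub_le (orbitZ q x (k + 2)) (orbitZ q x k) 1
  have d2' : |orbitZ q x (k + 2) - orbitZ q x k| ≤ C * S := d2.trans (by nlinarith)
  have hn2 : |orbitZ q x (k + 2) - 1| ≤ (1 - q) / 8 := by linarith
  have hz2pos : 0 < orbitZ q x (k + 2) := by linarith [(abs_le.1 hn2).1]
  have hU3 := orbitU_add_two_le_of_near_one hq0 hq1 (h1.trans (by linarith)) hn2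
  have hU3' : orbitU q x (k + 3) ≤ orbitU q x (k + 1) := by
    change orbitU q x (k + 1 + 2) ≤ _
    nlinarith
  have d3 := abs_orbitZ_add_two_sub_le hq0 (s := S) hw (by linarith) hz2pos (by linarith)
    (by change orbitU q x (k + 2) ≤ S; linarith) (by change orbitU q x (k + 3) ≤ S; linarith)
  have t3 := abs_sub_le (orbitZ q x (k + 1 + 2)) (orbitZ q x (k + 1)) 1
  have hsum : orbitU q x (k + 2) + orbitU q x (k + 2 + 1) ≤ (1 + q) / 2 * S := by
    rw [hS, mul_add]
    exact add_le_add hU2 hU3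
  have key : C * (orbitU q x (k + 2) + orbitU q x (k + 2 + 1)) ≤ C * S - 4 * S :=
    (mul_le_mul_of_nonneg_left hsum (by linarith)).trans
      (le_of_eq (by linear_combination (-(S / 2)) * hC))
  constructor
  · linarith
  · change |orbitZ q x (k + 1 + 2) - 1| ≤ _
    linarith

lemma orbitZ_pos_of_trapped {q x : ℝ} (hq0 : 0 < q) (hq1 : q < 1) {N : ℕ}
    (hpos : ∀ j ≤ N, 0 < orbitZ q x j) (h : Trapped q x N) (k : ℕ) : 0 < orbitZ q x k := by
  have hT : ∀ i, Trapped q x (N + 2 * i) := fun i => by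
    induction i with
    | zero => exact h
    | succ i ih => exact ih.add_two hq0 hq1
  rcases le_total k N with hk | hk
  · exact hpos k hk
  obtain ⟨i, hi | hi⟩ : ∃ i, k = N + 2 * i ∨ k = N + 2 * i + 1 := ⟨(k - N) / 2, by omega⟩
  · exact hi ▸ ((hT i).pos hq0 hq1).1
  · exact hi ▸ ((hT i).pos hq0 hq1).2

lemma infinite_setOf_orbitZ_pos {q : ℝ} (hq0 : 0 < q) (hq1 : q < 1) :
    {x : ℝ | ∀ k, 0 < orbitZ q x k}.Infinite := by
  have hlim : Tendsto (fun m : ℕ => 2 * q ^ m + 8 / (1 - q) * (2 * q ^ m + 2 * q ^ m)) atTop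
      (𝓝 (2 * 0 + 8 / (1 - q) * (2 * 0 + 2 * 0))) := by
    have h := (tendsto_pow_atTop_nhds_zero_of_lt_one hq0.le hq1).const_mul 2
    exact h.add ((h.add h).const_mul _)
  obtain ⟨m, hm⟩ := (hlim.eventually (gt_mem_nhds
    (show 2 * 0 + 8 / (1 - q) * (2 * 0 + 2 * 0) < (1 - q) / 8 by simp; linarith))).exists
  obtain ⟨x₀, hpos, hbal⟩ := exists_balanced hq0 hq1 (2 * m + 2)
  obtain ⟨hU2, hU3⟩ := orbitU_le_of_balanced hq0 hq1 m hpos hbal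
  have hcont : ∀ k ≤ 2 * m + 3, ContinuousAt (fun x => orbitZ q x k) x₀ ∧
      ContinuousAt (fun x => orbitU q x k) x₀ :=
    fun k hk => continuousAt_orbit hq0 x₀ k fun j hj => (hpos j (by omega)).ne'
  have hC : 0 < 8 / (1 - q) := div_pos (by norm_num) (by linarith)
  have hnear : |orbitZ q x₀ (2 * m + 2) - 1| ≤ 2 * q ^ m := by
    have hz := hpos (2 * m + 2) (by omega)
    have e := orbitZ_mul_succ hz.ne'
    rw [← hbal] at e
    have hu := orbitU_pos hq0 x₀ (2 * m + 2 + 1)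
    change orbitU q x₀ (2 * m + 2 + 1) ≤ _ at hU3
    rw [abs_le]
    constructor <;> nlinarith
  have hbound : 2 * q ^ m < (1 - q) / 8
      - 8 / (1 - q) * (orbitU q x₀ (2 * m + 2) + orbitU q x₀ (2 * m + 3)) := by
    have := mul_le_mul_of_nonneg_left (add_le_add hU2 hU3) hC.le
    linarith
  have hcr : ContinuousAt (fun x => (1 - q) / 8
      - 8 / (1 - q) * (orbitU q x (2 * m + 2) + orbitU q x (2 * m + 3))) x₀ :=
    continuousAt_const.sub (((hcont _ (by omega)).2.add (hcont _ le_rfl).2).const_mul _)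
  have ev1 : ∀ᶠ x in 𝓝 x₀, ∀ j ∈ Set.Iic (2 * m + 2), 0 < orbitZ q x j :=
    (eventually_all_finite (Set.finite_Iic _)).2 fun j hj =>
      (hcont j (le_trans hj (by omega))).1.eventually
        (lt_mem_nhds (hpos j (le_trans hj (by omega))))
  have ev2 := ((hcont (2 * m + 2) (by omega)).1.sub_const 1).abs.eventually_lt hcr
    (hnear.trans_lt hbound)
  have ev3 := ((hcont (2 * m + 3) le_rfl).1.sub_const 1).abs.eventually_lt hcr
    ((hbal ▸ hnear : |orbitZ q x₀ (2 * m + 2 + 1) - 1| ≤ 2 * q ^ m).trans_lt hbound)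
  refine infinite_of_mem_nhds x₀ ?_
  filter_upwards [ev1, ev2, ev3] with x h1 h2 h3
  exact orbitZ_pos_of_trapped hq0 hq1 h1 ⟨h2.le, h3.le⟩

/-! ### Back to the original recurrence -/

noncomputable def alphaSeq (q x : ℝ) : ℕ → ℝ
  | 0 => 0
  | k + 1 => orbitZ q x k / q ^ k

lemma alphaSeq_recurrence {q x : ℝ} (hq : 0 < q) (hpos : ∀ k, 0 < orbitZ q x k) (n : ℕ)
    (hn : 1 ≤ n) :
    alphaSeq q x n * (alphaSeq q x (n + 1) + q ^ ((n : ℤ) - 1) * alphaSeq q x n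
        + q ^ (-2 : ℤ) * alphaSeq q x (n - 1)
        - q ^ (2 * (n : ℤ) - 3) * alphaSeq q x (n + 1) * alphaSeq q x n * alphaSeq q x (n - 1))
      = (q ^ (-(n : ℤ)) - 1) * q ^ (1 - (n : ℤ)) := by
  have hq' := hq.ne'
  match n, hn with
  | 1, _ =>
    have e1 := orbitZ_mul_succ (hpos 0).ne'
    have e2 := orbitU_mul_succ hq x 0
    rw [orbitU_zero] at e2
    simp only [alphaSeq, Nat.sub_self, zero_add, pow_one, pow_zero, Nat.cast_one, sub_self,
      zpow_zero, mul_zero, add_zero, sub_zero, div_one, one_mul, mul_one, zpow_neg, zpow_one] at e1 e2 ⊢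
    field_simp
    linear_combination e1 - e2
  | k + 2, _ =>
    have e0 := orbitZ_mul_succ (hpos k).ne'
    have e1 := orbitZ_mul_succ (hpos (k + 1)).ne'
    have e2 := orbitU_mul_succ hq x (k + 1)
    have hu1 : orbitU q x (k + 1) = 1 - orbitZ q x k * orbitZ q x (k + 1) := by linarith
    have hu2 : orbitU q x (k + 1 + 1) = 1 - orbitZ q x (k + 1) * orbitZ q x (k + 1 + 1) := by
      linarith
    rw [hu1, hu2] at e2
    have p1 : q ^ (((k + 2 : ℕ) : ℤ) - 1) = q ^ k * q := by
      rw [show ((k + 2 : ℕ) : ℤ) - 1 = ((k + 1 : ℕ) : ℤ) by push_cast; ring, zpow_natCast, pow_succ]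
    have p2 : q ^ (2 * ((k + 2 : ℕ) : ℤ) - 3) = (q ^ k) ^ 2 * q := by
      rw [show 2 * ((k + 2 : ℕ) : ℤ) - 3 = ((2 * k + 1 : ℕ) : ℤ) by push_cast; ring, zpow_natCast]
      ring
    have p3 : q ^ (-((k + 2 : ℕ) : ℤ)) = (q ^ k * q ^ 2)⁻¹ := by
      rw [zpow_neg, zpow_natCast, pow_add]
    have p4 : q ^ (1 - ((k + 2 : ℕ) : ℤ)) = (q ^ k * q)⁻¹ := by
      rw [show 1 - ((k + 2 : ℕ) : ℤ) = -((k + 1 : ℕ) : ℤ) by push_cast; ring, zpow_neg,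
        zpow_natCast, pow_succ]
    have p5 : q ^ (-2 : ℤ) = (q ^ 2)⁻¹ := by
      rw [zpow_neg]; norm_cast
    rw [p1, p2, p3, p4, p5]
    simp only [alphaSeq, show k + 2 - 1 = k + 1 from rfl]
    have hQ : q ^ k ≠ 0 := by positivity
    rw [show k + 1 + 1 = k + 2 from rfl] at e2
    simp only [pow_add, pow_one] at e2 ⊢
    generalize q ^ k = Q at *
    field_simp
    linear_combination -e2

theorem statement16 (q : ℝ) (hq0 : 0 < q) (hq1 : q < 1) :
    {α : ℕ → ℝ |
      α 0 = 0 ∧ (∀ n : ℕ, 1 ≤ n → 0 < α n) ∧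
      ∀ n : ℕ, 1 ≤ n →
        α n * (α (n + 1) + q ^ ((n : ℤ) - 1) * α n + q ^ (-2 : ℤ) * α (n - 1)
            - q ^ (2 * (n : ℤ) - 3) * α (n + 1) * α n * α (n - 1))
          = (q ^ (-(n : ℤ)) - 1) * q ^ (1 - (n : ℤ))}.Infinite := by
  refine Set.infinite_of_injOn_mapsTo (f := alphaSeq q) (fun x _ y _ hxy => ?_)
    (fun x hx => ⟨rfl, fun n hn => ?_, alphaSeq_recurrence hq0 hx⟩)
    (infinite_setOf_orbitZ_pos hq0 hq1)
  · simpa [alphaSeq, orbitZ_zero] using congrFun hxy 1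
  · obtain ⟨k, rfl⟩ : ∃ k, n = k + 1 := ⟨n - 1, by omega⟩
    exact div_pos (hx k) (by positivity)
end

section
/- Let c ∈ (q, 1] with c ≠ 1 and c ≠ q^{1/2}, and let {P_n^{(c)}}_{n≥0} and {P_n^{(1)}}_{n≥0} be families of monic orthogonal polynomials on the lattices ±c q^ℤ and ±q^ℤ respectively, with weight w. Then the two families are not identical: there exists n with P_n^{(c)} ≠ P_n^{(1)}. -/
open Polynomial Topology

namespace QLattice

open Filter

/-- The triangular exponent `n (n - 1) / 2`. -/
def tri (n : ℤ) : ℤ := n * (n - 1) / 2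

lemma two_mul_tri (n : ℤ) : 2 * tri n = n * (n - 1) :=
  Int.mul_ediv_cancel' (Int.even_mul_pred_self n).two_dvd

lemma tri_zero : tri 0 = 0 := rfl

lemma tri_add_one (n : ℤ) : tri (n + 1) = tri n + n := by
  have h₁ := two_mul_tri (n + 1)
  have h₂ := two_mul_tri n
  linarith

lemma tri_sub (k n : ℤ) : tri (k - n) = tri k + tri n + n - k * n := by
  have h₁ := two_mul_tri (k - n)
  have h₂ := two_mul_tri n
  have h₃ := two_mul_tri k
  linarith

lemma tri_neg (n : ℤ) : tri (-n) = tri n + n := by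
  simpa [tri_zero] using tri_sub 0 n

/-- The general term of the bilateral theta series. -/
noncomputable def thetaTerm (p u : ℝ) (n : ℤ) : ℝ := p ^ tri n * u ^ n

/-- The bilateral theta series `∑ p^(n(n-1)/2) uⁿ`. -/
noncomputable def theta (p u : ℝ) : ℝ := ∑' n : ℤ, thetaTerm p u n

/-- The infinite product `∏ (1 + u pʲ)`. -/
noncomputable def qProd (p u : ℝ) : ℝ := ∏' j : ℕ, (1 + u * p ^ j)

/-- The reciprocal of `(p; p)ₙ`, extended by zero to negative `n`. -/
noncomputable def invPoch (p : ℝ) (n : ℤ) : ℝ :=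
  if 0 ≤ n then (∏ j ∈ Finset.range n.toNat, (1 - p ^ (j + 1)))⁻¹ else 0

variable {p : ℝ}

lemma summable_thetaTerm_nat (hp0 : 0 < p) (hp1 : p < 1) {u : ℝ} (hu : u ≠ 0) :
    Summable fun n : ℕ => thetaTerm p u n := by
  refine summable_of_ratio_test_tendsto_lt_one (l := 0) one_pos
    (Eventually.of_forall fun n => by unfold thetaTerm; positivity) ?_
  have h : ∀ n : ℕ, ‖thetaTerm p u (n + 1 : ℕ)‖ / ‖thetaTerm p u n‖ = |u| * p ^ n := by
    intro n
    rw [← norm_div, Real.norm_eq_abs]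
    unfold thetaTerm
    push_cast
    rw [tri_add_one, zpow_add₀ hp0.ne', zpow_add_one₀ hu]
    have : p ^ tri n * p ^ (n : ℤ) * (u ^ (n : ℤ) * u) / (p ^ tri n * u ^ (n : ℤ)) = u * p ^ n := by
      rw [zpow_natCast, zpow_natCast]
      field_simp
    rw [this, abs_mul, abs_of_pos (pow_pos hp0 n)]
  simp_rw [h]
  simpa using (tendsto_pow_atTop_nhds_zero_of_lt_one hp0.le hp1).const_mul |u|

lemma thetaTerm_neg (hp0 : 0 < p) (u : ℝ) (n : ℤ) :
    thetaTerm p u (-n) = thetaTerm p (p / u) n := by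
  unfold thetaTerm
  rw [tri_neg, zpow_add₀ hp0.ne', div_zpow, zpow_neg]
  ring

lemma summable_thetaTerm (hp0 : 0 < p) (hp1 : p < 1) {u : ℝ} (hu : u ≠ 0) :
    Summable (thetaTerm p u) := by
  refine Summable.of_nat_of_neg (summable_thetaTerm_nat hp0 hp1 hu) ?_
  simp_rw [thetaTerm_neg hp0]
  exact summable_thetaTerm_nat hp0 hp1 (div_ne_zero hp0.ne' hu)

lemma theta_div (hp0 : 0 < p) (u : ℝ) : theta p (p / u) = theta p u := by
  unfold theta
  simp_rw [← thetaTerm_neg hp0]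
  exact (Equiv.neg ℤ).tsum_eq (thetaTerm p u)

lemma theta_pos (hp0 : 0 < p) (hp1 : p < 1) {u : ℝ} (hu : 0 < u) : 0 < theta p u :=
  (summable_thetaTerm hp0 hp1 hu.ne').tsum_pos
    (fun n => by unfold thetaTerm; positivity) 0 (by unfold thetaTerm; positivity)

lemma summable_mul_pow (hp0 : 0 < p) (hp1 : p < 1) (u : ℝ) :
    Summable fun j : ℕ => ‖u * p ^ j‖ :=
  ((summable_geometric_of_lt_one hp0.le hp1).mul_left u).norm

lemma multipliable_qProd (hp0 : 0 < p) (hp1 : p < 1) (u : ℝ) :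
    Multipliable fun j : ℕ => 1 + u * p ^ j :=
  multipliable_one_add_of_summable (summable_mul_pow hp0 hp1 u)

lemma qProd_ne_zero (hp0 : 0 < p) (hp1 : p < 1) {u : ℝ} (hu : ∀ j : ℕ, 1 + u * p ^ j ≠ 0) :
    qProd p u ≠ 0 :=
  tprod_one_add_ne_zero_of_summable hu (summable_mul_pow hp0 hp1 u)

lemma qProd_ne_zero_of_pos (hp0 : 0 < p) (hp1 : p < 1) {u : ℝ} (hu : 0 < u) : qProd p u ≠ 0 :=
  qProd_ne_zero hp0 hp1 fun j => by positivity

lemma qProd_eq (hp0 : 0 < p) (hp1 : p < 1) (u : ℝ) :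
    qProd p u = (1 + u) * qProd p (p * u) := by
  have h : (fun j : ℕ => 1 + u * p ^ (j + 1)) = fun j : ℕ => 1 + p * u * p ^ j := by
    ext j; ring
  have hm := multipliable_qProd hp0 hp1 (p * u)
  rw [← h] at hm
  have hz := tprod_eq_zero_mul' (f := fun j : ℕ => 1 + u * p ^ j) hm
  rw [h, pow_zero, mul_one] at hz
  exact hz

lemma tendsto_prod_qProd (hp0 : 0 < p) (hp1 : p < 1) (u : ℝ) :
    Tendsto (fun N : ℕ => ∏ j ∈ Finset.range N, (1 + u * p ^ j)) atTop (𝓝 (qProd p u)) :=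
  (multipliable_qProd hp0 hp1 u).hasProd.tendsto_prod_nat

lemma invPoch_zero : invPoch p 0 = 1 := by simp [invPoch]

lemma invPoch_of_neg {n : ℤ} (hn : n < 0) : invPoch p n = 0 := by
  simp [invPoch, not_le.mpr hn]

lemma invPoch_natCast (n : ℕ) :
    invPoch p n = (∏ j ∈ Finset.range n, (1 - p ^ (j + 1)))⁻¹ := by
  simp [invPoch]

lemma one_sub_pow_pos (hp0 : 0 < p) (hp1 : p < 1) (j : ℕ) : 0 < 1 - p ^ (j + 1) :=
  sub_pos.mpr (pow_lt_one₀ hp0.le hp1 j.succ_ne_zero)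

lemma invPoch_nonneg (hp0 : 0 < p) (hp1 : p < 1) (n : ℤ) : 0 ≤ invPoch p n := by
  unfold invPoch
  split_ifs
  · exact inv_nonneg.mpr (Finset.prod_nonneg fun j _ => (one_sub_pow_pos hp0 hp1 j).le)
  · rfl

lemma invPoch_mul (hp0 : 0 < p) (hp1 : p < 1) (n : ℤ) :
    invPoch p n * (1 - p ^ n) = invPoch p (n - 1) := by
  rcases lt_trichotomy n 0 with hn | rfl | hn
  · rw [invPoch_of_neg hn, invPoch_of_neg (by omega), zero_mul]
  · rw [invPoch_of_neg (n := 0 - 1) (by omega)]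
    simp
  · obtain ⟨m, rfl⟩ : ∃ m : ℕ, n = (m + 1 : ℕ) := ⟨(n - 1).toNat, by omega⟩
    have h : ((m + 1 : ℕ) : ℤ) - 1 = (m : ℕ) := by push_cast; ring
    rw [h, invPoch_natCast, invPoch_natCast, Finset.prod_range_succ, mul_inv, zpow_natCast,
      mul_assoc, inv_mul_cancel₀ (one_sub_pow_pos hp0 hp1 m).ne', mul_one]

lemma qProd_neg_self_ne_zero (hp0 : 0 < p) (hp1 : p < 1) : qProd p (-p) ≠ 0 :=
  qProd_ne_zero hp0 hp1 fun j => by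
    have := one_sub_pow_pos hp0 hp1 j
    rw [pow_succ'] at this
    linarith

lemma tendsto_invPoch (hp0 : 0 < p) (hp1 : p < 1) :
    Tendsto (fun n : ℕ => invPoch p n) atTop (𝓝 (qProd p (-p))⁻¹) := by
  refine ((tendsto_prod_qProd hp0 hp1 (-p)).inv₀ (qProd_neg_self_ne_zero hp0 hp1)).congr
    fun n => ?_
  rw [invPoch_natCast]
  congr 1
  exact Finset.prod_congr rfl fun j _ => by ring

lemma exists_invPoch_le (hp0 : 0 < p) (hp1 : p < 1) : ∃ C : ℝ, ∀ n : ℤ, invPoch p n ≤ C := by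
  obtain ⟨C, hC⟩ := (tendsto_invPoch hp0 hp1).bddAbove_range
  refine ⟨C, fun n => ?_⟩
  rcases lt_or_ge n 0 with hn | hn
  · rw [invPoch_of_neg hn]
    exact (invPoch_nonneg hp0 hp1 (0 : ℕ)).trans (hC ⟨0, rfl⟩)
  · lift n to ℕ using hn
    exact hC ⟨n, rfl⟩

lemma summable_mul_invPoch (hp0 : 0 < p) (hp1 : p < 1) {f : ℤ → ℝ} (hf : Summable f) :
    Summable fun n => f n * invPoch p n := by
  obtain ⟨C, hC⟩ := exists_invPoch_le hp0 hp1
  refine Summable.of_norm_bounded (hf.norm.mul_right C) fun n => ?_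
  rw [norm_mul, Real.norm_of_nonneg (invPoch_nonneg hp0 hp1 _)]
  exact mul_le_mul_of_nonneg_left (hC _) (norm_nonneg _)

/-- Euler's series for `qProd`. -/
noncomputable def eulerSeries (p u : ℝ) : ℝ := ∑' n : ℤ, thetaTerm p u n * invPoch p n

lemma eulerSeries_eq (hp0 : 0 < p) (hp1 : p < 1) {u : ℝ} (hu : u ≠ 0) :
    eulerSeries p u = (1 + u) * eulerSeries p (p * u) := by
  have hs := summable_mul_invPoch hp0 hp1 (summable_thetaTerm hp0 hp1 hu)
  have hs' := summable_mul_invPoch hp0 hp1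
    (summable_thetaTerm hp0 hp1 (mul_ne_zero hp0.ne' hu))
  have h : eulerSeries p u - eulerSeries p (p * u) = u * eulerSeries p (p * u) := by
    unfold eulerSeries
    rw [← hs.tsum_sub hs', ← tsum_mul_left, ← (Equiv.addRight (1 : ℤ)).tsum_eq]
    refine tsum_congr fun n => ?_
    have hr := invPoch_mul hp0 hp1 (n + 1)
    rw [add_sub_cancel_right] at hr
    simp only [Equiv.coe_addRight, ← hr, thetaTerm, mul_zpow, tri_add_one,
      zpow_add₀ hp0.ne', zpow_add₀ hu, zpow_one]
    ring
  linarith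

lemma eulerSeries_eq_prod (hp0 : 0 < p) (hp1 : p < 1) {u : ℝ} (hu : u ≠ 0) (N : ℕ) :
    eulerSeries p u = (∏ j ∈ Finset.range N, (1 + u * p ^ j)) * eulerSeries p (u * p ^ N) := by
  induction N with
  | zero => simp
  | succ N ih =>
    rw [ih, eulerSeries_eq hp0 hp1 (mul_ne_zero hu (pow_ne_zero N hp0.ne')),
      Finset.prod_range_succ, mul_assoc, show p * (u * p ^ N) = u * p ^ (N + 1) by ring]

lemma tendsto_eulerSeries (hp0 : 0 < p) (hp1 : p < 1) {u : ℝ} (hu : u ≠ 0) :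
    Tendsto (fun N : ℕ => eulerSeries p (u * p ^ N)) atTop (𝓝 1) := by
  have hs := summable_mul_invPoch hp0 hp1 (summable_thetaTerm hp0 hp1 hu)
  have hone : (∑' n : ℤ, if n = 0 then (1 : ℝ) else 0) = 1 := tsum_ite_eq 0 _
  rw [← hone]
  have hterm : ∀ (N : ℕ) (n : ℕ), thetaTerm p (u * p ^ N) n * invPoch p n =
      thetaTerm p u n * invPoch p n * (p ^ n) ^ N := by
    intro N n
    simp only [thetaTerm, zpow_natCast, mul_pow, ← pow_mul, mul_comm n N]
    ring
  refine tendsto_tsum_of_dominated_convergence hs.norm (fun n => ?_)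
    (Eventually.of_forall fun N n => ?_)
  · rcases lt_or_ge n 0 with hn | hn
    · simp [invPoch_of_neg hn, hn.ne]
    · lift n to ℕ using hn
      simp_rw [hterm]
      rcases Nat.eq_zero_or_pos n with rfl | hn
      · simp [thetaTerm, tri_zero, invPoch_zero]
      · have := (tendsto_pow_atTop_nhds_zero_of_lt_one (pow_nonneg hp0.le n)
          (pow_lt_one₀ hp0.le hp1 hn.ne')).const_mul (thetaTerm p u n * invPoch p n)
        simpa [hn.ne'] using this
  · rcases lt_or_ge n 0 with hn | hn
    · simp [invPoch_of_neg hn]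
    · lift n to ℕ using hn
      rw [hterm, norm_mul]
      refine mul_le_of_le_one_right (norm_nonneg _) ?_
      rw [Real.norm_of_nonneg (by positivity)]
      exact pow_le_one₀ (by positivity) (pow_le_one₀ hp0.le hp1.le)

lemma qProd_eq_eulerSeries (hp0 : 0 < p) (hp1 : p < 1) {u : ℝ} (hu : u ≠ 0) :
    qProd p u = eulerSeries p u := by
  have h := (tendsto_prod_qProd hp0 hp1 u).mul (tendsto_eulerSeries hp0 hp1 hu)
  simp_rw [← eulerSeries_eq_prod hp0 hp1 hu, mul_one] at h
  exact tendsto_nhds_unique h tendsto_const_nhds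

lemma tendsto_qProd (hp0 : 0 < p) (hp1 : p < 1) {u : ℝ} (hu : u ≠ 0) :
    Tendsto (fun N : ℕ => qProd p (u * p ^ N)) atTop (𝓝 1) := by
  refine (tendsto_eulerSeries hp0 hp1 hu).congr fun N => ?_
  rw [qProd_eq_eulerSeries hp0 hp1 (mul_ne_zero hu (pow_ne_zero N hp0.ne'))]

lemma qProd_mul_qProd (hp0 : 0 < p) (hp1 : p < 1) {x : ℝ} (hx : x ≠ 0) (k : ℤ) :
    qProd p x * qProd p (p / x) =
      qProd p (x * p ^ k) * (thetaTerm p x k * qProd p (p * p ^ (-k) / x)) := by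
  have step : ∀ k : ℤ, qProd p (x * p ^ k) * (thetaTerm p x k * qProd p (p * p ^ (-k) / x)) =
      qProd p (x * p ^ (k + 1)) *
        (thetaTerm p x (k + 1) * qProd p (p * p ^ (-(k + 1)) / x)) := by
    intro k
    have h₁ := qProd_eq hp0 hp1 (x * p ^ k)
    have h₂ := qProd_eq hp0 hp1 (p * p ^ (-(k + 1)) / x)
    have e₁ : p * (x * p ^ k) = x * p ^ (k + 1) := by rw [zpow_add_one₀ hp0.ne']; ring
    have e₂ : p * p ^ (-(k + 1)) = p ^ (-k) := by
      rw [← zpow_one_add₀ hp0.ne']; congr 1; ring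
    have e₃ : p * (p * p ^ (-(k + 1)) / x) = p * p ^ (-k) / x := by rw [e₂]; ring
    rw [e₁] at h₁
    rw [e₃] at h₂
    rw [h₁, h₂, e₂]
    have e₄ : thetaTerm p x (k + 1) * (1 + p ^ (-k) / x) = thetaTerm p x k * (1 + x * p ^ k) := by
      have := zpow_ne_zero k hp0.ne'
      simp only [thetaTerm, tri_add_one, zpow_add₀ hp0.ne', zpow_add_one₀ hx, zpow_neg]
      field_simp
      ring
    linear_combination (-(qProd p (x * p ^ (k + 1)) * qProd p (p * p ^ (-k) / x))) * e₄
  induction k with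
  | zero => simp [thetaTerm, tri_zero]
  | succ k ih => rw [ih, step]
  | pred k ih =>
    rw [ih, step (-(k : ℤ) - 1), sub_add_cancel]

lemma thetaTerm_mul_qProd (hp0 : 0 < p) (hp1 : p < 1) {x : ℝ} (hx : x ≠ 0) (k : ℤ) :
    thetaTerm p x k * qProd p (p * p ^ (-k) / x) =
      ∑' n : ℤ, thetaTerm p x (k - n) * invPoch p n := by
  have hne : p * p ^ (-k) / x ≠ 0 :=
    div_ne_zero (mul_ne_zero hp0.ne' (zpow_ne_zero _ hp0.ne')) hx
  rw [qProd_eq_eulerSeries hp0 hp1 hne, eulerSeries, ← tsum_mul_left]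
  refine tsum_congr fun n => ?_
  have e : p ^ tri (k - n) = p ^ tri k * p ^ tri n * p ^ n * (p ^ (-k)) ^ n := by
    rw [tri_sub, ← zpow_mul, ← zpow_add₀ hp0.ne', ← zpow_add₀ hp0.ne', ← zpow_add₀ hp0.ne']
    congr 1; ring
  simp only [thetaTerm, e, div_zpow, mul_zpow, zpow_sub₀ hx]
  ring

/-- The Jacobi triple product identity. -/
lemma theta_eq_qProd (hp0 : 0 < p) (hp1 : p < 1) {x : ℝ} (hx : x ≠ 0) :
    theta p x * (qProd p (-p))⁻¹ = qProd p x * qProd p (p / x) := by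
  have hs := summable_thetaTerm hp0 hp1 hx
  obtain ⟨C, hC⟩ := exists_invPoch_le hp0 hp1
  have hlim : Tendsto (fun K : ℕ => ∑' m : ℤ, thetaTerm p x m * invPoch p (K - m)) atTop
      (𝓝 (∑' m : ℤ, thetaTerm p x m * (qProd p (-p))⁻¹)) := by
    refine tendsto_tsum_of_dominated_convergence (hs.norm.mul_right C) (fun m => ?_)
      (Eventually.of_forall fun K m => ?_)
    · refine Tendsto.const_mul _ ?_
      have ht : Tendsto (fun K : ℕ => ((K : ℤ) - m).toNat) atTop atTop :=
        tendsto_atTop.mpr fun b => by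
          filter_upwards [eventually_ge_atTop (b + m.toNat)] with K hK
          omega
      refine ((tendsto_invPoch hp0 hp1).comp ht).congr' ?_
      filter_upwards [eventually_ge_atTop m.toNat] with K hK
      simp only [Function.comp]
      congr 1
      omega
    · rw [norm_mul, Real.norm_of_nonneg (invPoch_nonneg hp0 hp1 _)]
      exact mul_le_mul_of_nonneg_left (hC _) (norm_nonneg _)
  have hlim' := (tendsto_qProd hp0 hp1 hx).mul hlim
  rw [one_mul, tsum_mul_right] at hlim'
  refine tendsto_nhds_unique hlim' (tendsto_const_nhds.congr fun K => ?_)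
  rw [qProd_mul_qProd hp0 hp1 hx K, thetaTerm_mul_qProd hp0 hp1 hx, zpow_natCast,
    ← (Equiv.subLeft (K : ℤ)).tsum_eq]
  simp

/-- The generating function `∑ zⁿ / (p; p)ₙ`. -/
noncomputable def expSeries (p z : ℝ) : ℝ := ∑' n : ℤ, z ^ n * invPoch p n

lemma summable_expSeries (hp0 : 0 < p) (hp1 : p < 1) {z : ℝ} (hz0 : 0 < z) (hz1 : z < 1) :
    Summable fun n : ℤ => z ^ n * invPoch p n := by
  obtain ⟨C, hC⟩ := exists_invPoch_le hp0 hp1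
  refine Summable.of_nat_of_neg_add_one ?_ ?_
  · refine Summable.of_nonneg_of_le
      (fun n => mul_nonneg (by positivity) (invPoch_nonneg hp0 hp1 _)) (fun n => ?_)
      ((summable_geometric_of_lt_one hz0.le hz1).mul_right C)
    rw [zpow_natCast]
    exact mul_le_mul_of_nonneg_left (hC _) (by positivity)
  · refine summable_zero.congr fun n => ?_
    rw [invPoch_of_neg (by omega), mul_zero]

lemma expSeries_pos (hp0 : 0 < p) (hp1 : p < 1) {z : ℝ} (hz0 : 0 < z) (hz1 : z < 1) :
    0 < expSeries p z :=
  (summable_expSeries hp0 hp1 hz0 hz1).tsum_pos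
    (fun n => mul_nonneg (by positivity) (invPoch_nonneg hp0 hp1 n)) 0 (by simp [invPoch_zero])

/-- The case `b = 0` of Ramanujan's `₁ψ₁` summation. -/
lemma tsum_zpow_div_qProd (hp0 : 0 < p) (hp1 : p < 1) {x z : ℝ} (hx : 0 < x) (hz0 : 0 < z)
    (hz1 : z < 1) :
    qProd p x * qProd p (p / x) * ∑' k : ℤ, z ^ k * (qProd p (x * p ^ k))⁻¹ =
      theta p (z * x) * expSeries p z := by
  have hf := summable_thetaTerm hp0 hp1 (mul_pos hz0 hx).ne'
  have hg := summable_expSeries hp0 hp1 hz0 hz1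
  have hprod : Summable fun y : ℤ × ℤ =>
      thetaTerm p (z * x) y.1 * (z ^ y.2 * invPoch p y.2) :=
    hf.mul_of_nonneg hg (fun n => by unfold thetaTerm; positivity)
      (fun n => mul_nonneg (by positivity) (invPoch_nonneg hp0 hp1 n))
  let e : ℤ × ℤ ≃ ℤ × ℤ :=
    { toFun := fun y => (y.2 - y.1, y.1)
      invFun := fun y => (y.2, y.1 + y.2)
      left_inv := fun y => by simp
      right_inv := fun y => by simp }
  have hcomm : Summable (Function.uncurry fun n k : ℤ =>
      thetaTerm p (z * x) (k - n) * (z ^ n * invPoch p n)) :=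
    e.summable_iff.mpr hprod
  rw [← tsum_mul_left]
  calc ∑' k : ℤ, qProd p x * qProd p (p / x) * (z ^ k * (qProd p (x * p ^ k))⁻¹)
      = ∑' k : ℤ, ∑' n : ℤ, thetaTerm p (z * x) (k - n) * (z ^ n * invPoch p n) := by
        refine tsum_congr fun k => ?_
        have hne : qProd p (x * p ^ k) ≠ 0 := qProd_ne_zero_of_pos hp0 hp1 (by positivity)
        rw [qProd_mul_qProd hp0 hp1 hx.ne' k, thetaTerm_mul_qProd hp0 hp1 hx.ne']
        rw [mul_comm (z ^ k), mul_mul_mul_comm, mul_inv_cancel₀ hne, one_mul, ← tsum_mul_right]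
        refine tsum_congr fun n => ?_
        have : z ^ k = z ^ (k - n) * z ^ n := by rw [← zpow_add₀ hz0.ne']; simp
        rw [this]
        simp only [thetaTerm, mul_zpow]
        ring
    _ = ∑' n : ℤ, ∑' k : ℤ, thetaTerm p (z * x) (k - n) * (z ^ n * invPoch p n) :=
        hcomm.tsum_comm
    _ = ∑' n : ℤ, theta p (z * x) * (z ^ n * invPoch p n) := by
        refine tsum_congr fun n => ?_
        rw [tsum_mul_right, theta]
        congr 1
        exact (Equiv.subRight n).tsum_eq (thetaTerm p (z * x))
    _ = theta p (z * x) * expSeries p z := by rw [tsum_mul_left, expSeries]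

lemma hasSum_int_even_add_odd {f : ℤ → ℝ} {a b : ℝ} (he : HasSum (fun k => f (2 * k)) a)
    (ho : HasSum (fun k => f (2 * k + 1)) b) : HasSum f (a + b) := by
  have hinj : Function.Injective fun k : ℤ => 2 * k := fun a b h => by simpa using h
  replace ho := ((add_left_injective (1 : ℤ)).comp hinj).hasSum_range_iff.2 ho
  refine (hinj.hasSum_range_iff.2 he).add_isCompl ?_ ho
  convert! Int.isCompl_even_odd using 1
  · ext n; simp [even_iff_exists_two_mul]
  · ext n; simp [Odd, eq_comm]

variable {q c : ℝ}

lemma theta_neg_sq (hq0 : 0 < q) (hq1 : q < 1) (hc : 0 < c) :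
    theta q (-c ^ 2) = theta (q ^ 4) (q * c ^ 4) - c ^ 2 * theta (q ^ 4) (q ^ 3 * c ^ 4) := by
  have hp0 : 0 < q ^ 4 := by positivity
  have hp1 : q ^ 4 < 1 := pow_lt_one₀ hq0.le hq1 (by norm_num)
  have h₁ := (summable_thetaTerm hp0 hp1 (u := q * c ^ 4) (by positivity)).hasSum
  have h₂ := ((summable_thetaTerm hp0 hp1 (u := q ^ 3 * c ^ 4) (by positivity)).hasSum).mul_left
    (-c ^ 2)
  have hsq : ∀ k : ℤ, (-c ^ 2) ^ (2 * k) = (c ^ 4) ^ k := fun k => by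
    rw [zpow_mul]; congr 1; norm_cast; ring
  have h4 : ∀ k : ℤ, (q ^ 4) ^ tri k = q ^ (4 * tri k) := fun k => by
    rw [zpow_mul]; norm_cast
  have h := hasSum_int_even_add_odd (f := thetaTerm q (-c ^ 2))
    (h₁.congr_fun ?_) (h₂.congr_fun ?_)
  · rw [theta, h.tsum_eq, theta, theta]
    ring
  · intro k
    have e : tri (2 * k) = 4 * tri k + k := by
      have h₁ := two_mul_tri (2 * k)
      have h₂ := two_mul_tri k
      linarith
    simp only [thetaTerm, e, hsq, h4, mul_zpow, zpow_add₀ hq0.ne']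
    ring
  · intro k
    have e : tri (2 * k + 1) = 4 * tri k + 3 * k := by
      have h₁ := two_mul_tri (2 * k + 1)
      have h₂ := two_mul_tri k
      linarith
    have h3 : (q ^ 3) ^ k = q ^ (3 * k) := by
      rw [zpow_mul]; norm_cast
    have hne : -c ^ 2 ≠ 0 := neg_ne_zero.mpr (by positivity)
    simp only [thetaTerm, e, zpow_add_one₀ hne, hsq, h4, mul_zpow, h3, zpow_add₀ hq0.ne']
    ring

lemma theta_neg_sq_ne_zero (hq0 : 0 < q) (hq1 : q < 1) (hqc : q < c) (hc1 : c < 1)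
    (hc : c ≠ √q) : theta q (-c ^ 2) ≠ 0 := by
  have hc0 : 0 < c := hq0.trans hqc
  have hne : -c ^ 2 ≠ 0 := neg_ne_zero.mpr (by positivity)
  have hsq1 : c ^ 2 < 1 := pow_lt_one₀ hc0.le hc1 two_ne_zero
  have hsqq : q ^ 2 < c ^ 2 := pow_lt_pow_left₀ hqc hq0.le two_ne_zero
  have hcq : c ^ 2 ≠ q := fun h => hc (by rw [← h, Real.sqrt_sq hc0.le])
  refine left_ne_zero_of_mul (b := (qProd q (-q))⁻¹) ?_
  rw [theta_eq_qProd hq0 hq1 hne]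
  refine mul_ne_zero (qProd_ne_zero hq0 hq1 fun j => ?_) (qProd_ne_zero hq0 hq1 fun j => ?_)
  · have h₁ : q ^ j ≤ 1 := pow_le_one₀ hq0.le hq1.le
    have h₂ : c ^ 2 * q ^ j ≤ c ^ 2 := mul_le_of_le_one_right (by positivity) h₁
    linarith
  · have h₁ : c ^ 2 ≠ q ^ (j + 1) := by
      rcases j with _ | j
      · simpa using hcq
      · have : q ^ (j + 1 + 1) ≤ q ^ 2 := pow_le_pow_of_le_one hq0.le hq1.le (by omega)
        linarith
    intro h
    apply h₁
    field_simp at h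
    linear_combination h

lemma qweight_eq (hq0 : 0 < q) (hq1 : q < 1) (x : ℝ) :
    qweight q x = (qProd (q ^ 4) (x ^ 4))⁻¹ := by
  have hp0 : 0 < q ^ 4 := by positivity
  have hp1 : q ^ 4 < 1 := pow_lt_one₀ hq0.le hq1 (by norm_num)
  have hne : qProd (q ^ 4) (x ^ 4) ≠ 0 := qProd_ne_zero hp0 hp1 fun j => by positivity
  unfold qweight
  simp_rw [pow_mul]
  exact (multipliable_qProd hp0 hp1 (x ^ 4)).tprod_inv₀ hne

lemma tsum_zpow_mul_qweight (hq0 : 0 < q) (hq1 : q < 1) (hc : 0 < c) {z : ℝ} (hz0 : 0 < z)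
    (hz1 : z < 1) :
    qProd (q ^ 4) (c ^ 4) * qProd (q ^ 4) (q ^ 4 / c ^ 4) *
        ∑' k : ℤ, z ^ k * qweight q (c * q ^ k) =
      theta (q ^ 4) (z * c ^ 4) * expSeries (q ^ 4) z := by
  have hp0 : 0 < q ^ 4 := by positivity
  have hp1 : q ^ 4 < 1 := pow_lt_one₀ hq0.le hq1 (by norm_num)
  rw [← tsum_zpow_div_qProd hp0 hp1 (by positivity) hz0 hz1]
  congr 1
  refine tsum_congr fun k => ?_
  rw [qweight_eq hq0 hq1, mul_pow]
  congr 4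
  rw [← zpow_natCast, ← zpow_natCast, ← zpow_mul, ← zpow_mul, mul_comm]

lemma qweight_neg (q x : ℝ) : qweight q (-x) = qweight q x := by
  unfold qweight
  simp_rw [Even.neg_pow (by decide : Even 4)]

/-- Orthogonality of `P₂` to constants, in terms of the moments of order `0` and `2`. -/
lemma moment_relation (F : MonicOrthFamily q c) :
    c ^ 2 * ∑' k : ℤ, (q ^ 3) ^ k * qweight q (c * q ^ k) +
      (F.P 2).coeff 0 * ∑' k : ℤ, q ^ k * qweight q (c * q ^ k) = 0 := by
  have hP0 : F.P 0 = 1 := Polynomial.eq_one_of_monic_natDegree_zero (F.monic 0) (F.deg 0)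
  have hP2 : ∀ x : ℝ, (F.P 2).eval x = (F.P 2).coeff 0 + (F.P 2).coeff 1 * x + x ^ 2 := by
    intro x
    have hlead : (F.P 2).coeff 2 = 1 := by
      have := (F.monic 2).coeff_natDegree
      rwa [F.deg 2] at this
    rw [eval_eq_sum_range, F.deg 2]
    simp [Finset.sum_range_succ, hlead]
  set d := (F.P 2).coeff 0
  have hcube : ∀ k : ℤ, (q ^ 3) ^ k = (q ^ k) ^ 2 * q ^ k := fun k => by
    rw [← pow_succ, ← zpow_natCast, ← zpow_natCast, ← zpow_mul, ← zpow_mul, mul_comm]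
  have hs₀ := (F.abs_summable 0 0).of_abs
  have hs₂ := (F.abs_summable 2 0).of_abs
  have ho := F.orth 2 0
  simp only [hP0, hP2, qweight_neg, eval_one] at hs₀ hs₂ ho
  have hA : Summable fun k : ℤ => q ^ k * qweight q (c * q ^ k) :=
    (hs₀.mul_left (1 / 2)).congr fun k => by ring
  have hB : Summable fun k : ℤ => c ^ 2 * ((q ^ 3) ^ k * qweight q (c * q ^ k)) :=
    ((hs₂.mul_left (1 / 2)).sub (hA.mul_left d)).congr fun k => by rw [hcube]; ring
  rw [← tsum_mul_left, ← tsum_mul_left, ← hB.tsum_add (hA.mul_left d)]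
  rw [if_neg (by norm_num)] at ho
  rw [← mul_zero (1 / 2 : ℝ), ← ho, ← tsum_mul_left]
  refine tsum_congr fun k => ?_
  rw [hcube]
  ring

end QLattice

theorem statement18 (q c : ℝ) (hq0 : 0 < q) (hq1 : q < 1)
    (hc1 : q < c) (hc2 : c ≤ 1) (hcne1 : c ≠ 1) (hcne2 : c ≠ Real.sqrt q)
    (F : MonicOrthFamily q c) (G : MonicOrthFamily q 1) :
    ∃ n : ℕ, F.P n ≠ G.P n := by
  by_contra! hFG
  have hc0 : 0 < c := hq0.trans hc1
  have hp0 : 0 < q ^ 4 := by positivity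
  have hp1 : q ^ 4 < 1 := pow_lt_one₀ hq0.le hq1 (by norm_num)
  have hz0 : 0 < q ^ 3 := by positivity
  have hz1 : q ^ 3 < 1 := pow_lt_one₀ hq0.le hq1 (by norm_num)
  have hF := QLattice.moment_relation F
  have hG := QLattice.moment_relation G
  rw [hFG 2] at hF
  have hFA := QLattice.tsum_zpow_mul_qweight hq0 hq1 hc0 hq0 hq1
  have hFB := QLattice.tsum_zpow_mul_qweight hq0 hq1 hc0 hz0 hz1
  have hGA := QLattice.tsum_zpow_mul_qweight hq0 hq1 one_pos hq0 hq1
  have hGB := QLattice.tsum_zpow_mul_qweight hq0 hq1 one_pos hz0 hz1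
  have hsymm : QLattice.theta (q ^ 4) (q ^ 3 * 1 ^ 4) = QLattice.theta (q ^ 4) (q * 1 ^ 4) := by
    rw [← QLattice.theta_div hp0]
    congr 1
    field_simp
  rw [hsymm] at hGB
  have hθ : QLattice.theta (q ^ 4) (q * 1 ^ 4) ≠ 0 :=
    (QLattice.theta_pos hp0 hp1 (by positivity)).ne'
  have hE₁ := (QLattice.expSeries_pos hp0 hp1 hq0 hq1).ne'
  have hE₃ := (QLattice.expSeries_pos hp0 hp1 hz0 hz1).ne'
  refine QLattice.theta_neg_sq_ne_zero hq0 hq1 hc1 (lt_of_le_of_ne hc2 hcne1) hcne2 ?_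
  rw [QLattice.theta_neg_sq hq0 hq1 hc0]
  refine mul_left_cancel₀ (mul_ne_zero (mul_ne_zero hθ hE₁) hE₃) (Eq.trans ?_ (mul_zero _).symm)
  generalize QLattice.qProd (q ^ 4) (c ^ 4) * QLattice.qProd (q ^ 4) (q ^ 4 / c ^ 4) = C at *
  generalize QLattice.qProd (q ^ 4) (1 ^ 4) * QLattice.qProd (q ^ 4) (q ^ 4 / 1 ^ 4) = D at *
  generalize (∑' k : ℤ, q ^ k * qweight q (c * q ^ k)) = A at *
  generalize (∑' k : ℤ, (q ^ 3) ^ k * qweight q (c * q ^ k)) = B at *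
  generalize (∑' k : ℤ, q ^ k * qweight q (1 * q ^ k)) = A' at *
  generalize (∑' k : ℤ, (q ^ 3) ^ k * qweight q (1 * q ^ k)) = B' at *
  have hcross : A * B' - c ^ 2 * B * A' = 0 := by linear_combination A * hG - A' * hF
  calc _ = QLattice.theta (q ^ 4) (q * c ^ 4) * QLattice.expSeries (q ^ 4) q *
          (QLattice.theta (q ^ 4) (q * 1 ^ 4) * QLattice.expSeries (q ^ 4) (q ^ 3)) -
        c ^ 2 * (QLattice.theta (q ^ 4) (q ^ 3 * c ^ 4) * QLattice.expSeries (q ^ 4) (q ^ 3)) *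
          (QLattice.theta (q ^ 4) (q * 1 ^ 4) * QLattice.expSeries (q ^ 4) q) := by ring
    _ = C * D * (A * B' - c ^ 2 * B * A') := by rw [← hFA, ← hFB, ← hGA, ← hGB]; ring
    _ = 0 := by rw [hcross, mul_zero]
end
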